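/- arXiv:2002.10035 — 3 statements merged into one kernel-verified Lean document; each statement's English description precedes it below -/
import Mathlib

section
/- Let q be a prime power and suppose there exists a set of N four-dimensional subspaces of F_q^8 whose pairwise subspace distance is at least 4. Then there exists a set of N·q^{12} + (q^{12} + 2q^{10} + 3q^9 + 5q^8 + q^7 + 2q^6 + q^5 + 7q^4 + q^3 + q^2 + 1) four-dimensional subspaces of F_q^{12} whose pairwise subspace distance is at least 4; in other words, A_q(12,4,4) ≥ A_q(8,4,4)·q^{12} + q^{12} + 2q^{10} + 3q^9 + 5q^8 + q^7 + 2q^6 + q^5 + 7q^4 + q^3 + q^2 + 1. -/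
/-- The subspace distance `d_S(U,W) = 2·dim(U+W) − dim U − dim W` between two
subspaces of an `F`-vector space. -/
noncomputable def subspaceDist {F V : Type*} [Field F] [AddCommGroup V] [Module F V]
    (U W : Submodule F V) : ℕ :=
  2 * Module.finrank F ↥(U ⊔ W) - Module.finrank F ↥U - Module.finrank F ↥W

/-- The row space `im(A)` of a matrix `A`, i.e. the span of its rows. -/
def rowSpace {F : Type*} [Field F] {k n : ℕ} (A : Matrix (Fin k) (Fin n) F) :
    Submodule F (Fin n → F) :=
  Submodule.span F (Set.range fun i : Fin k => A i)

/-- Horizontal concatenation `(U | M)` of two matrices with the same number of rows. -/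
def hcat {F : Type*} [Field F] {k n1 n2 : ℕ} (U : Matrix (Fin k) (Fin n1) F)
    (M : Matrix (Fin k) (Fin n2) F) : Matrix (Fin k) (Fin (n1 + n2)) F :=
  Matrix.of fun i => Fin.append (U i) (M i)

/-- The projection of `F^(n1+n2)` onto the first `n1` coordinates. -/
noncomputable def proj1 (F : Type*) [Field F] (n1 n2 : ℕ) :
    (Fin (n1 + n2) → F) →ₗ[F] (Fin n1 → F) :=
  LinearMap.funLeft F F (Fin.castAdd n2)

open Module

/-- A family of 4-dimensional subspaces any two of which meet in dimension at most 2. -/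
def IsCode (F : Type*) {V ι : Type*} [Field F] [AddCommGroup V] [Module F V]
    (G : ι → Submodule F V) : Prop :=
  (∀ i, finrank F ↥(G i) = 4) ∧ ∀ i j, i ≠ j → finrank F ↥(G i ⊓ G j) ≤ 2

section Codes

variable {F V V' ι κ : Type*} [Field F] [AddCommGroup V] [Module F V]
  [AddCommGroup V'] [Module F V']

theorem four_le_subspaceDist_iff [FiniteDimensional F V] {X Y : Submodule F V}
    (hX : finrank F ↥X = 4) (hY : finrank F ↥Y = 4) :
    4 ≤ subspaceDist X Y ↔ finrank F ↥(X ⊓ Y) ≤ 2 := by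
  have := Submodule.finrank_sup_add_finrank_inf_eq X Y
  unfold subspaceDist
  omega

theorem IsCode.injective {G : ι → Submodule F V} (h : IsCode F G) : Function.Injective G := by
  intro i j hij
  by_contra hne
  have h2 := h.2 i j hne
  rw [hij, inf_idem, h.1 j] at h2
  omega

theorem IsCode.sumElim {G : ι → Submodule F V} {H : κ → Submodule F V} (hG : IsCode F G)
    (hH : IsCode F H) (h : ∀ i j, finrank F ↥(G i ⊓ H j) ≤ 2) : IsCode F (Sum.elim G H) := by
  refine ⟨?_, ?_⟩
  · rintro (i | i)
    · exact hG.1 i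
    · exact hH.1 i
  · rintro (i | i) (j | j) hij
    · exact hG.2 i j (by simpa using hij)
    · exact h i j
    · rw [inf_comm]
      exact h j i
    · exact hH.2 i j (by simpa using hij)

theorem IsCode.map {G : ι → Submodule F V} (hG : IsCode F G) (e : V →ₗ[F] V')
    (he : Function.Injective e) : IsCode F fun i => (G i).map e := by
  refine ⟨fun i => ?_, fun i j hij => ?_⟩
  · rw [(Submodule.equivMapOfInjective e he (G i)).finrank_eq.symm, hG.1]
  · rw [← Submodule.map_inf e he, (Submodule.equivMapOfInjective e he _).finrank_eq.symm]
    exact hG.2 i j hij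

/-- A code of size at least `m` contains a set of exactly `m` subspaces with pairwise
subspace distance at least 4. -/
theorem IsCode.exists_set [FiniteDimensional F V] [Finite ι] {G : ι → Submodule F V}
    (hG : IsCode F G) {m : ℕ} (hm : m ≤ Nat.card ι) :
    ∃ S : Set (Submodule F V), S.ncard = m ∧ (∀ X ∈ S, finrank F ↥X = 4) ∧
      ∀ X ∈ S, ∀ Y ∈ S, X ≠ Y → 4 ≤ subspaceDist X Y := by
  have hc : m ≤ (Set.range G).ncard := by
    rwa [← Set.image_univ, Set.ncard_image_of_injective _ hG.injective, Set.ncard_univ]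
  obtain ⟨S, hS, hSm⟩ := Set.exists_subset_card_eq hc
  refine ⟨S, hSm, fun X hX => ?_, fun X hX Y hY hXY => ?_⟩
  · obtain ⟨i, rfl⟩ := hS hX
    exact hG.1 i
  · obtain ⟨i, rfl⟩ := hS hX
    obtain ⟨j, rfl⟩ := hS hY
    rw [four_le_subspaceDist_iff (hG.1 i) (hG.1 j)]
    exact hG.2 i j fun h => hXY (by rw [h])

theorem finrank_le_map_fst_add_comap_inr [FiniteDimensional F V] [FiniteDimensional F V']
    (D : Submodule F (V × V')) :
    finrank F ↥D ≤ finrank F ↥(D.map (LinearMap.fst F V V')) +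
      finrank F ↥(D.comap (LinearMap.inr F V V')) := by
  have h := ((LinearMap.fst F V V').domRestrict D).finrank_range_add_finrank_ker
  rw [LinearMap.range_domRestrict] at h
  rw [← h]
  refine Nat.add_le_add_left ?_ _
  let f : ↥((LinearMap.fst F V V').domRestrict D).ker →ₗ[F]
      ↥(D.comap (LinearMap.inr F V V')) :=
    LinearMap.codRestrict _ (LinearMap.snd F V V' ∘ₗ D.subtype ∘ₗ Submodule.subtype _) (by
      rintro ⟨⟨⟨v, w⟩, hD⟩, hk⟩
      simp only [LinearMap.mem_ker, LinearMap.domRestrict_apply, LinearMap.fst_apply] at hk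
      subst hk
      simpa using hD)
  refine LinearMap.finrank_le_finrank_of_injective (f := f) ?_
  rintro ⟨⟨⟨v, w⟩, hD⟩, hk⟩ ⟨⟨⟨v', w'⟩, hD'⟩, hk'⟩ h0
  simp only [LinearMap.mem_ker, LinearMap.domRestrict_apply, LinearMap.fst_apply] at hk hk'
  have hw : w = w' := congrArg Subtype.val h0
  subst hk hk' hw
  rfl

end Codes

section Linkage

variable {F P E : Type*} [Field F] [AddCommGroup P] [Module F P] [AddCommGroup E] [Module F E]

theorem comap_inr_range_prod (X : Submodule F P)
    (f : X →ₗ[F] E) :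
    (X.subtype.prod f).range.comap (LinearMap.inr F P E) = ⊥ := by
  rw [eq_bot_iff]
  rintro e ⟨x, hx⟩
  simp only [LinearMap.prod_apply, Function.prod_apply, LinearMap.inr_apply,
    Prod.mk.injEq] at hx
  have : x = 0 := Subtype.ext hx.1
  subst this
  simpa using hx.2.symm

variable [FiniteDimensional F P] [FiniteDimensional F E]

/-- The linkage construction: graphs of the maps of a rank-metric code over the
members of a constant-dimension code. -/
theorem isCode_linkage {S : Set (Submodule F P)} (hS : ∀ X ∈ S, finrank F ↥X = 4)
    (hdist : ∀ X ∈ S, ∀ Y ∈ S, X ≠ Y → finrank F ↥(X ⊓ Y) ≤ 2)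
    (ρ : ∀ X : S, ↥X.1 ≃ₗ[F] E) (C : Submodule F (E →ₗ[F] E))
    (hC : ∀ f ∈ C, f ≠ 0 → finrank F ↥f.ker ≤ 2) :
    IsCode F fun i : S × C =>
      (i.1.1.subtype.prod (i.2.1 ∘ₗ (ρ i.1).toLinearMap)).range := by
  refine ⟨fun i => ?_, ?_⟩
  · rw [LinearMap.finrank_range_of_inj, hS _ i.1.2]
    intro x y hxy
    exact Subtype.ext (congrArg Prod.fst hxy)
  · rintro ⟨X, f⟩ ⟨Y, g⟩ hij
    refine (finrank_le_map_fst_add_comap_inr _).trans ?_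
    rw [Submodule.comap_inf, comap_inr_range_prod, bot_inf_eq, finrank_bot, add_zero]
    by_cases hXY : X = Y
    · subst hXY
      have hfg : f.1 - g.1 ≠ 0 := fun h => hij (by
        rw [Subtype.ext (sub_eq_zero.1 h)])
      refine le_trans ?_ (hC _ (C.sub_mem f.2 g.2) hfg)
      refine le_trans (Submodule.finrank_mono (t := ((f.1 - g.1).ker.map
        ((ρ X).symm.toLinearMap)).map X.1.subtype) ?_)
        ((Submodule.finrank_map_le _ _).trans (Submodule.finrank_map_le _ _))
      rintro _ ⟨⟨p, e⟩, ⟨⟨x, hx⟩, ⟨y, hy⟩⟩, rfl⟩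
      simp only [LinearMap.prod_apply, Function.prod_apply, Prod.mk.injEq] at hx hy
      have hxy : x = y := Subtype.ext (hx.1.trans hy.1.symm)
      subst hxy
      refine ⟨x, ⟨ρ X x, ?_, by simp⟩, hx.1⟩
      have := hx.2.trans hy.2.symm
      simpa [sub_eq_zero] using this
    · refine le_trans (Submodule.finrank_mono ?_)
        (hdist X.1 X.2 Y.1 Y.2 fun h => hXY (Subtype.ext h))
      rintro _ ⟨⟨p, e⟩, ⟨⟨x, hx⟩, ⟨y, hy⟩⟩, rfl⟩
      simp only [LinearMap.prod_apply, Function.prod_apply, Prod.mk.injEq] at hx hy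
      refine ⟨?_, ?_⟩
      · simp [← hx.1]
      · simp [← hy.1]

/-- In a field extension of degree `n` there is an `n (n - 1)`-dimensional space of
endomorphisms whose nonzero members all have rank at least 2. -/
theorem exists_rank_code (F E : Type*) [Field F] [Field E] [Algebra F E]
    [FiniteDimensional F E] :
    ∃ C : Submodule F (E →ₗ[F] E),
      finrank F E * finrank F E ≤ finrank F ↥C + finrank F E ∧
      ∀ f ∈ C, f ≠ 0 → finrank F ↥f.ker + 2 ≤ finrank F E := by
  let e := finBasis F E
  let τ : (E →ₗ[F] E) →ₗ[F] E :=
    ∑ i, LinearMap.mulLeft F (e i) ∘ₗ LinearMap.applyₗ (e i)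
  have hτ (f : E →ₗ[F] E) : τ f = ∑ i, e i * f (e i) := by simp [τ]
  refine ⟨τ.ker, ?_, fun f hf hf0 => ?_⟩
  · have h := τ.finrank_range_add_finrank_ker
    rw [Module.finrank_linearMap] at h
    have := τ.range.finrank_le
    omega
  · have h := f.finrank_range_add_finrank_ker
    suffices ¬ finrank F ↥f.range ≤ 1 by omega
    intro h1
    obtain ⟨y, hy⟩ := finrank_le_one_iff.1 h1
    choose c hc using fun i => hy ⟨f (e i), LinearMap.mem_range_self f (e i)⟩
    have hc' (i) : f (e i) = c i • (y : E) := (congrArg Subtype.val (hc i)).symm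
    have h0 : (∑ i, c i • e i) * (y : E) = 0 := by
      rw [← LinearMap.mem_ker.1 hf, hτ, Finset.sum_mul]
      refine Finset.sum_congr rfl fun i _ => ?_
      rw [hc' i]
      simp
    refine hf0 (e.ext fun i => ?_)
    rw [hc' i]
    rcases mul_eq_zero.1 h0 with h0 | h0
    · rw [Fintype.linearIndependent_iff.1 e.linearIndependent c h0 i]
      simp
    · simp [h0]

/-- A 4-dimensional subspace that contains a 2-dimensional subspace of `0 × E` meets any
subspace disjoint from `0 × E` in dimension at most 2. -/
theorem finrank_inf_le_two {G W : Submodule F (P × E)} (hW : finrank F ↥W = 4)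
    (hWE : 2 ≤ finrank F ↥(W.comap (LinearMap.inr F P E)))
    (hG : G.comap (LinearMap.inr F P E) = ⊥) : finrank F ↥(G ⊓ W) ≤ 2 := by
  set Z := (W.comap (LinearMap.inr F P E)).map (LinearMap.inr F P E)
  have hZr : finrank F ↥Z = finrank F ↥(W.comap (LinearMap.inr F P E)) :=
    (Submodule.equivMapOfInjective _ LinearMap.inr_injective _).finrank_eq.symm
  have hdisj : (G ⊓ W) ⊓ Z = ⊥ := by
    rw [eq_bot_iff]
    rintro _ ⟨⟨hxG, -⟩, ⟨e, -, rfl⟩⟩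
    have : e ∈ G.comap (LinearMap.inr F P E) := hxG
    rw [hG, Submodule.mem_bot] at this
    simp [this]
  have h := Submodule.finrank_sup_add_finrank_inf_eq (G ⊓ W) Z
  rw [hdisj, finrank_bot] at h
  have hle : (G ⊓ W) ⊔ Z ≤ W := sup_le inf_le_right (Submodule.map_comap_le _ _)
  have := Submodule.finrank_mono hle
  omega

end Linkage

section Level

variable {F K M E Λ : Type*} [Field F] [Field K] [Algebra F K]
  [AddCommGroup M] [Module F M] [Module K M] [IsScalarTower F K M]
  [AddCommGroup E] [Module F E]

/-- The map `((k, v), e) ↦ (v - k a - σ(k) b, ψ(e) - k c)`. -/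
def liftMap (σ : K →ₗ[F] K) (ψ : E →ₗ[F] K) (b a : M) (c : K) :
    (K × M) × E →ₗ[F] M × K :=
  LinearMap.prod
    (LinearMap.snd F K M ∘ₗ LinearMap.fst F (K × M) E -
      ((LinearMap.toSpanSingleton K M a).restrictScalars F +
        (LinearMap.toSpanSingleton K M b).restrictScalars F ∘ₗ σ) ∘ₗ
        LinearMap.fst F K M ∘ₗ LinearMap.fst F (K × M) E)
    (ψ ∘ₗ LinearMap.snd F (K × M) E -
      LinearMap.mulRight F c ∘ₗ LinearMap.fst F K M ∘ₗ LinearMap.fst F (K × M) E)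

theorem mem_ker_liftMap {σ : K →ₗ[F] K} {ψ : E →ₗ[F] K} {b a : M} {c k : K} {v : M} {e : E} :
    ((k, v), e) ∈ (liftMap σ ψ b a c).ker ↔ v = k • a + σ k • b ∧ ψ e = k * c := by
  simp [liftMap, sub_eq_zero]

theorem liftMap_surjective (σ : K →ₗ[F] K) {ψ : E →ₗ[F] K} (hψ : Function.Surjective ψ)
    (b a : M) (c : K) : Function.Surjective (liftMap σ ψ b a c) := by
  rintro ⟨x, y⟩
  obtain ⟨e, rfl⟩ := hψ y
  exact ⟨((0, x), e), by simp [liftMap]⟩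

theorem comap_inr_ker_liftMap (σ : K →ₗ[F] K) (ψ : E →ₗ[F] K) (b a : M) (c : K) :
    (liftMap σ ψ b a c).ker.comap (LinearMap.inr F (K × M) E) = ψ.ker := by
  ext e
  refine (mem_ker_liftMap (k := 0) (v := 0)).trans ?_
  simp

theorem exists_linearMap_not_smul (hK : finrank F K = 2) :
    ∃ σ : K →ₗ[F] K, σ 1 = 0 ∧ ∃ k, σ k ≠ 0 := by
  have hlt : F ∙ (1 : K) < ⊤ := by
    have : FiniteDimensional F K := FiniteDimensional.of_finrank_pos (by omega)
    refine Submodule.lt_top_of_finrank_lt_finrank ?_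
    rw [finrank_span_singleton one_ne_zero]
    omega
  obtain ⟨f, hf, hle⟩ := Submodule.exists_le_ker_of_lt_top _ hlt
  refine ⟨Algebra.linearMap F K ∘ₗ f, ?_, ?_⟩
  · have : f 1 = 0 := hle (Submodule.mem_span_singleton_self 1)
    simp [this]
  · by_contra! h
    exact hf (LinearMap.ext fun k => by simpa using h k)

theorem finrank_ker_eq_two [FiniteDimensional F E] (hK : finrank F K = 2)
    (hE : finrank F E = 4) {ψ : E →ₗ[F] K} (hψ : Function.Surjective ψ) :
    finrank F ↥ψ.ker = 2 := by
  have := ψ.finrank_range_add_finrank_ker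
  rw [LinearMap.range_eq_top.2 hψ, finrank_top] at this
  omega

/-- Kernels of the maps `liftMap` with fixed `σ` that is not `K`-linear form a code. -/
theorem isCode_ker_liftMap [FiniteDimensional F M] [FiniteDimensional F E]
    (hK : finrank F K = 2) (hE : finrank F E = 4)
    {σ : K →ₗ[F] K} (hσ1 : σ 1 = 0) (hσ : ∃ k, σ k ≠ 0) {ψ : Λ → E →ₗ[F] K}
    (hψ : ∀ l, Function.Surjective (ψ l)) (hker : Function.Injective fun l => (ψ l).ker)
    {b : Λ → M} (hb : Function.Injective b) :
    IsCode F fun i : Λ × M × K => (liftMap σ (ψ i.1) (b i.1) i.2.1 i.2.2).ker := by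
  have : FiniteDimensional F K := FiniteDimensional.of_finrank_pos (by omega)
  have hk2 (l) := finrank_ker_eq_two hK hE (hψ l)
  refine ⟨?_, ?_⟩
  · rintro ⟨l, a, c⟩
    have h := (liftMap σ (ψ l) (b l) a c).finrank_range_add_finrank_ker
    rw [LinearMap.range_eq_top.2 (liftMap_surjective σ (hψ l) _ _ _), finrank_top] at h
    simp only [finrank_prod] at h
    dsimp only
    omega
  · rintro ⟨l, a, c⟩ ⟨l', a', c'⟩ hij
    refine (finrank_le_map_fst_add_comap_inr _).trans ?_
    rw [Submodule.comap_inf, comap_inr_ker_liftMap, comap_inr_ker_liftMap]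
    dsimp only
    set D := (liftMap σ (ψ l) (b l) a c).ker ⊓ (liftMap σ (ψ l') (b l') a' c').ker
    by_cases hl : l = l'
    · subst hl
      rw [inf_idem, hk2]
      suffices D.map (LinearMap.fst F (K × M) E) = ⊥ by rw [this, finrank_bot]
      rw [eq_bot_iff]
      rintro _ ⟨⟨⟨k, v⟩, e⟩, ⟨h1, h2⟩, rfl⟩
      obtain ⟨hv, he⟩ := mem_ker_liftMap.1 h1
      obtain ⟨hv', he'⟩ := mem_ker_liftMap.1 h2
      have hk : k = 0 := by
        by_contra hk
        refine hij ?_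
        have ha : k • a = k • a' := by
          rw [hv] at hv'
          exact add_right_cancel hv'
        rw [smul_right_injective M hk ha, mul_left_cancel₀ hk (he.symm.trans he')]
      subst hk
      simp [hv]
    · have hinf : finrank F ↥((ψ l).ker ⊓ (ψ l').ker) ≤ 1 := by
        by_contra! h
        refine hl (hker ?_)
        have h1 := Submodule.eq_of_le_of_finrank_le
          (inf_le_left : (ψ l).ker ⊓ (ψ l').ker ≤ _) (by rw [hk2]; omega)
        have h2 := Submodule.eq_of_le_of_finrank_le
          (inf_le_right : (ψ l).ker ⊓ (ψ l').ker ≤ _) (by rw [hk2]; omega)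
        exact h1.symm.trans h2
      suffices finrank F ↥(D.map (LinearMap.fst F (K × M) E)) ≤ 1 by omega
      have hmem {k : K} {v : M} (h : (k, v) ∈ D.map (LinearMap.fst F (K × M) E)) :
          v = k • a + σ k • b l ∧ v = k • a' + σ k • b l' := by
        obtain ⟨⟨⟨k', v'⟩, e⟩, ⟨h1, h2⟩, h3⟩ := h
        obtain ⟨rfl, rfl⟩ := Prod.mk.inj h3
        exact ⟨(mem_ker_liftMap.1 h1).1, (mem_ker_liftMap.1 h2).1⟩
      let p := (LinearMap.fst F K M).domRestrict (D.map (LinearMap.fst F (K × M) E))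
      have hp : Function.Injective p := by
        refine (injective_iff_map_eq_zero p).2 ?_
        rintro ⟨⟨k, v⟩, h⟩ h0
        have h0 : k = 0 := h0
        subst h0
        have := (hmem h).1
        simp only [zero_smul, map_zero, add_zero] at this
        subst this
        rfl
      rw [← LinearMap.finrank_range_of_inj hp]
      by_contra! h
      have htop : p.range = ⊤ := Submodule.eq_top_of_finrank_eq
        (le_antisymm p.range.finrank_le (by omega))
      have hall (k : K) : k • a + σ k • b l = k • a' + σ k • b l' := by
        obtain ⟨⟨⟨k', v⟩, hm⟩, hk'⟩ := (htop ▸ Submodule.mem_top : k ∈ p.range)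
        have hk' : k' = k := hk'
        subst hk'
        exact (hmem hm).1.symm.trans (hmem hm).2
      have ha : a = a' := by simpa [hσ1] using hall 1
      obtain ⟨k, hk⟩ := hσ
      have h3 := hall k
      rw [ha] at h3
      exact hl (hb (smul_right_injective M hk (add_left_cancel h3)))

end Level

section Counting

theorem exists_injective_of_le_card {α : Type*} [Finite α] {n : ℕ} (h : n ≤ Nat.card α) :
    ∃ f : Fin n → α, Function.Injective f :=
  ⟨(Finite.equivFin α).symm ∘ Fin.castLE h,
    (Finite.equivFin α).symm.injective.comp (Fin.castLE_injective h)⟩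

theorem exists_surjective_ker_eq {F E K : Type*} [Field F] [AddCommGroup E] [Module F E]
    [AddCommGroup K] [Module F K] [FiniteDimensional F E] [FiniteDimensional F K]
    (L : Submodule F E) (hL : finrank F ↥L + finrank F K = finrank F E) :
    ∃ ψ : E →ₗ[F] K, Function.Surjective ψ ∧ ψ.ker = L := by
  have h := L.finrank_quotient_add_finrank
  let e : (E ⧸ L) ≃ₗ[F] K := LinearEquiv.ofFinrankEq _ _ (by omega)
  refine ⟨e.toLinearMap ∘ₗ L.mkQ, e.surjective.comp L.mkQ_surjective, ?_⟩
  rw [LinearEquiv.ker_comp, Submodule.ker_mkQ]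

/-- Lower bound on the number of 2-dimensional subspaces of a 4-dimensional space. -/
theorem le_card_finrank_eq_two {F E : Type*} [Field F] [Fintype F] [AddCommGroup E]
    [Module F E] [Finite E] (hE : finrank F E = 4) :
    (Fintype.card F ^ 2 + 1) * (Fintype.card F ^ 2 + Fintype.card F + 1) ≤
      Nat.card {L : Submodule F E // finrank F ↥L = 2} := by
  have := Fintype.ofFinite E
  have hT := card_linearIndependent (K := F) (V := E) (k := 2) (by omega)
  have hL (L : {L : Submodule F E // finrank F ↥L = 2}) :
      Nat.card {s : Fin 2 → L.1 // LinearIndependent F s} =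
        ∏ i : Fin 2, (Fintype.card F ^ 2 - Fintype.card F ^ i.val) := by
    have := Fintype.ofFinite L.1
    rw [card_linearIndependent (K := F) (V := L.1) (k := 2) L.2.ge, L.2]
  let g : {s : Fin 2 → E // LinearIndependent F s} →
      Σ L : {L : Submodule F E // finrank F ↥L = 2},
        {s : Fin 2 → L.1 // LinearIndependent F s} := fun s =>
    ⟨⟨Submodule.span F (Set.range s.1), by rw [finrank_span_eq_card s.2, Fintype.card_fin]⟩,
      ⟨fun i => ⟨s.1 i, Submodule.subset_span (Set.mem_range_self i)⟩,
        .of_comp (Submodule.subtype _) s.2⟩⟩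
  have hg : Function.Injective g := fun s t hst => by
    have := congrArg (fun x : (Σ L : {L : Submodule F E // finrank F ↥L = 2},
      {s : Fin 2 → L.1 // LinearIndependent F s}) => fun i => (x.2.1 i : E)) hst
    exact Subtype.ext this
  have := Fintype.ofFinite {L : Submodule F E // finrank F ↥L = 2}
  have hle := Nat.card_le_card_of_injective g hg
  rw [Nat.card_sigma, Finset.sum_congr rfl fun L _ => hL L, hT, hE, Finset.sum_const,
    Finset.card_univ, smul_eq_mul,
    ← Nat.card_eq_fintype_card (α := {L : Submodule F E // finrank F ↥L = 2})] at hle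
  have hq := Fintype.one_lt_card (α := F)
  generalize Fintype.card F = q at *
  simp only [Fin.prod_univ_two, Fin.val_zero, Fin.val_one, pow_zero, pow_one] at hle
  obtain ⟨r, rfl⟩ : ∃ r, q = r + 1 := ⟨q - 1, by omega⟩
  have h1 : (r + 1) ^ 2 - 1 = r * (r + 2) := Nat.sub_eq_of_eq_add (by ring)
  have h2 : (r + 1) ^ 2 - (r + 1) = r * (r + 1) := Nat.sub_eq_of_eq_add (by ring)
  have h3 : (r + 1) ^ 4 - 1 = r * (r + 2) * ((r + 1) ^ 2 + 1) :=
    Nat.sub_eq_of_eq_add (by ring)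
  have h4 : (r + 1) ^ 4 - (r + 1) = r * (r + 1) * ((r + 1) ^ 2 + (r + 1) + 1) :=
    Nat.sub_eq_of_eq_add (by ring)
  rw [h1, h2, h3, h4] at hle
  have hr : 0 < r * (r + 2) * (r * (r + 1)) := by
    have : 0 < r := by omega
    positivity
  refine Nat.le_of_mul_le_mul_left ?_ hr
  calc _ = _ := by ring
    _ ≤ _ := hle
    _ = _ := by ring

theorem exists_surjections {F E K : Type*} [Field F] [Fintype F] [AddCommGroup E] [Module F E]
    [AddCommGroup K] [Module F K] [Finite E] [FiniteDimensional F K]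
    (hE : finrank F E = 4) (hK : finrank F K = 2) {n : ℕ}
    (hn : n ≤ (Fintype.card F ^ 2 + 1) * (Fintype.card F ^ 2 + Fintype.card F + 1)) :
    ∃ ψ : Fin n → E →ₗ[F] K, (∀ l, Function.Surjective (ψ l)) ∧
      Function.Injective fun l => (ψ l).ker := by
  obtain ⟨L, hL⟩ := exists_injective_of_le_card (hn.trans (le_card_finrank_eq_two hE))
  choose ψ hψ hker using fun l => exists_surjective_ker_eq (K := K) (L l).1
    (by rw [(L l).2, hE, hK])
  refine ⟨ψ, hψ, fun l l' h => hL (Subtype.ext ?_)⟩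
  simpa only [hker] using h

theorem exists_extension (F : Type*) [Field F] [Finite F] (n : ℕ) [NeZero n] :
    ∃ (K : Type) (_ : Field K) (_ : Algebra F K), Finite K ∧ finrank F K = n := by
  obtain ⟨p, _⟩ := CharP.exists F
  have : Fact p.Prime := ⟨CharP.char_is_prime F p⟩
  exact ⟨FiniteField.Extension F p n, inferInstance, inferInstance, inferInstance,
    FiniteField.finrank_extension F p n⟩

theorem size_le {q : ℕ} (hq : 1 < q) :
    q ^ 12 + 2 * q ^ 10 + 3 * q ^ 9 + 5 * q ^ 8 + q ^ 7 + 2 * q ^ 6 + q ^ 5 + 7 * q ^ 4 + q ^ 3 +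
      q ^ 2 + 1 ≤ (q ^ 2 + 1) * (q ^ 2 + q + 1) * q ^ 8 + q ^ 10 := by
  obtain ⟨r, rfl⟩ := Nat.exists_eq_add_of_le hq
  zify
  rw [← sub_nonneg]
  ring_nf
  positivity

end Counting

section Assembly

variable {F K M E : Type*} [Field F] [Field K] [Algebra F K]
  [AddCommGroup M] [Module F M]
  [AddCommGroup E] [Module F E]

variable (F K M E) in
/-- The embedding `((k, v), e) ↦ ((0, (k, v)), e)`. -/
def shift : (K × M) × E →ₗ[F] (K × (K × M)) × E :=
  LinearMap.prodMap (LinearMap.inr F K (K × M)) LinearMap.id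

theorem shift_injective : Function.Injective (shift F K M E) := by
  rintro ⟨x, e⟩ ⟨x', e'⟩ h
  simpa [shift] using h

/-- From a code in `F^8`, the linkage construction together with two further families
of subspaces meeting `0 × E` in dimension 2 gives a code in `F^12`. -/
theorem exists_code {F K E : Type} [Field F] [Fintype F] [Field K] [Algebra F K] [Finite K]
    [Field E] [Algebra F E] [Finite E] (hK : finrank F K = 2) (hE : finrank F E = 4)
    {S : Set (Submodule F (K × (K × (K × K))))} (hS : ∀ X ∈ S, finrank F ↥X = 4)
    (hdist : ∀ X ∈ S, ∀ Y ∈ S, X ≠ Y → finrank F ↥(X ⊓ Y) ≤ 2) :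
    ∃ (ι : Type) (G : ι → Submodule F ((K × (K × (K × K))) × E)), Finite ι ∧ IsCode F G ∧
      S.ncard * Fintype.card F ^ 12 +
        ((Fintype.card F ^ 2 + 1) * (Fintype.card F ^ 2 + Fintype.card F + 1) *
          Fintype.card F ^ 8 + Fintype.card F ^ 10) ≤ Nat.card ι := by
  have hq := Fintype.one_lt_card (α := F)
  have hcK : Nat.card K = Fintype.card F ^ 2 := by
    rw [natCard_eq_pow_finrank (K := F), hK, Nat.card_eq_fintype_card]
  obtain ⟨C, hCdim, hC⟩ := exists_rank_code F E
  obtain ⟨σ, hσ1, hσ⟩ := exists_linearMap_not_smul hK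
  obtain ⟨ψ₁, hψ₁, hker₁⟩ := exists_surjections (F := F) (K := K) hE hK le_rfl
  obtain ⟨ψ₂, hψ₂, hker₂⟩ := exists_surjections (F := F) (K := K) (n := Fintype.card F ^ 4)
    hE hK (by nlinarith)
  obtain ⟨b₁, hb₁⟩ := exists_injective_of_le_card (α := K × (K × K))
    (n := (Fintype.card F ^ 2 + 1) * (Fintype.card F ^ 2 + Fintype.card F + 1)) (by
      simp only [Nat.card_prod, hcK]
      generalize Fintype.card F = q at hq
      obtain ⟨r, rfl⟩ := Nat.exists_eq_add_of_le hq
      ring_nf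
      nlinarith [sq_nonneg r, Nat.zero_le (r ^ 3)])
  obtain ⟨b₂, hb₂⟩ := exists_injective_of_le_card (α := K × K) (n := Fintype.card F ^ 4) (by
    simp only [Nat.card_prod, hcK]
    exact le_of_eq (by ring))
  let ρ (X : S) : ↥X.1 ≃ₗ[F] E := LinearEquiv.ofFinrankEq _ _ (by rw [hS _ X.2, hE])
  have hA := isCode_linkage hS hdist ρ C fun f hf hf0 => by
    have := hC f hf hf0
    omega
  have hB := isCode_ker_liftMap hK hE hσ1 hσ hψ₁ hker₁ hb₁
  have hD := isCode_ker_liftMap hK hE hσ1 hσ hψ₂ hker₂ hb₂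
  have hD' := hD.map (shift F K (K × K) E) shift_injective
  have : Finite (E →ₗ[F] E) := Module.finite_of_finite F
  refine ⟨_, _, inferInstance, hA.sumElim (hB.sumElim hD' ?_) ?_, ?_⟩
  · rintro i j
    rw [inf_comm]
    refine (Submodule.finrank_mono (t := (ψ₁ i.1).ker.map (LinearMap.inr F _ E)) ?_).trans
      ((Submodule.finrank_map_le _ _).trans (finrank_ker_eq_two hK hE (hψ₁ i.1)).le)
    rintro _ ⟨⟨⟨⟨k, v⟩, e⟩, -, rfl⟩, h⟩
    obtain ⟨hv, he⟩ := (mem_ker_liftMap (k := 0) (v := (k, v)) (e := e)).1 h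
    simp only [zero_smul, map_zero, add_zero, zero_mul] at hv he
    exact ⟨e, he, Prod.ext (Prod.ext rfl hv.symm) rfl⟩
  · rintro i (j | j)
    · refine finrank_inf_le_two (hB.1 j) ?_ (comap_inr_range_prod _ _)
      rw [Sum.elim_inl, comap_inr_ker_liftMap, finrank_ker_eq_two hK hE (hψ₁ _)]
    · refine finrank_inf_le_two (hD'.1 j) ?_ (comap_inr_range_prod _ _)
      refine (finrank_ker_eq_two hK hE (hψ₂ j.1)).ge.trans (Submodule.finrank_mono ?_)
      rw [← comap_inr_ker_liftMap σ (ψ₂ j.1) (b₂ j.1) j.2.1 j.2.2]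
      exact fun e he => ⟨(0, e), he, rfl⟩
  · have hcC : Fintype.card F ^ 12 ≤ Nat.card C := by
      rw [natCard_eq_pow_finrank (K := F), Nat.card_eq_fintype_card]
      refine Nat.pow_le_pow_right hq.le ?_
      rw [hE] at hCdim
      omega
    simp only [Nat.card_sum, Nat.card_prod, hcK, Nat.card_eq_fintype_card (α := Fin _),
      Fintype.card_fin, Nat.card_coe_set_eq]
    refine Nat.add_le_add (Nat.mul_le_mul_left _ hcC) (le_of_eq ?_)
    ring

/-- Coordinate-free form of the size bound: a code in an 8-dimensional space yields a code in a
12-dimensional space. -/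
theorem exists_code_transport {F K E V₁ V₂ : Type} [Field F] [Fintype F] [Field K] [Algebra F K]
    [Finite K] [Field E] [Algebra F E] [Finite E] [AddCommGroup V₁] [Module F V₁]
    [AddCommGroup V₂] [Module F V₂] [FiniteDimensional F V₁] [FiniteDimensional F V₂]
    (hK : finrank F K = 2) (hE : finrank F E = 4) (hV₁ : finrank F V₁ = 8)
    (hV₂ : finrank F V₂ = 12) {S : Set (Submodule F V₁)} (hS : ∀ X ∈ S, finrank F ↥X = 4)
    (hdist : ∀ X ∈ S, ∀ Y ∈ S, X ≠ Y → 4 ≤ subspaceDist X Y) :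
    ∃ (ι : Type) (G : ι → Submodule F V₂), Finite ι ∧ IsCode F G ∧
      S.ncard * Fintype.card F ^ 12 +
        ((Fintype.card F ^ 2 + 1) * (Fintype.card F ^ 2 + Fintype.card F + 1) *
          Fintype.card F ^ 8 + Fintype.card F ^ 10) ≤ Nat.card ι := by
  obtain ⟨e₁⟩ : Nonempty (V₁ ≃ₗ[F] K × (K × (K × K))) :=
    FiniteDimensional.nonempty_linearEquiv_of_finrank_eq (by
      rw [hV₁, finrank_prod, finrank_prod, finrank_prod, hK])
  obtain ⟨e₂⟩ : Nonempty (((K × (K × (K × K))) × E) ≃ₗ[F] V₂) :=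
    FiniteDimensional.nonempty_linearEquiv_of_finrank_eq (by
      rw [hV₂, finrank_prod, finrank_prod, finrank_prod, finrank_prod, hK, hE])
  have hS₀ : IsCode F fun X : S => X.1 :=
    ⟨fun X => hS X.1 X.2, fun X Y hXY =>
      (four_le_subspaceDist_iff (hS X.1 X.2) (hS Y.1 Y.2)).1
        (hdist X.1 X.2 Y.1 Y.2 fun h => hXY (Subtype.ext h))⟩
  have hS' := hS₀.map e₁.toLinearMap e₁.injective
  have hcard : (Set.range fun X : S => X.1.map e₁.toLinearMap).ncard = S.ncard := by
    rw [← Set.image_univ, Set.ncard_image_of_injective _ hS'.injective, Set.ncard_univ,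
      Nat.card_coe_set_eq]
  obtain ⟨ι, G, hfin, hG, hι⟩ := exists_code hK hE
    (S := Set.range fun X : S => X.1.map e₁.toLinearMap)
    (by rintro _ ⟨X, rfl⟩; exact hS'.1 X)
    (by rintro _ ⟨X, rfl⟩ _ ⟨Y, rfl⟩ hXY; exact hS'.2 X Y fun h => hXY (by rw [h]))
  rw [hcard] at hι
  exact ⟨ι, _, hfin, hG.map e₂.toLinearMap e₂.injective, hι⟩

end Assembly

theorem statement8 (q N : ℕ) (hq : IsPrimePow q)
    (F : Type) [Field F] [Fintype F] (hcard : Fintype.card F = q)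
    (h : ∃ S : Set (Submodule F (Fin 8 → F)), S.ncard = N ∧
      (∀ X ∈ S, Module.finrank F ↥X = 4) ∧
      (∀ X ∈ S, ∀ Y ∈ S, X ≠ Y → 4 ≤ subspaceDist X Y)) :
    ∃ S : Set (Submodule F (Fin 12 → F)),
      S.ncard = N * q ^ 12 + (q ^ 12 + 2 * q ^ 10 + 3 * q ^ 9 + 5 * q ^ 8 + q ^ 7 + 2 * q ^ 6 + q ^ 5 + 7 * q ^ 4 + q ^ 3 + q ^ 2 + 1) ∧
      (∀ X ∈ S, Module.finrank F ↥X = 4) ∧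
      (∀ X ∈ S, ∀ Y ∈ S, X ≠ Y → 4 ≤ subspaceDist X Y) := by
  subst hcard
  obtain ⟨S, rfl, hS, hdist⟩ := h
  obtain ⟨K, _, _, _, hK⟩ := exists_extension F 2
  obtain ⟨E, _, _, _, hE⟩ := exists_extension F 4
  obtain ⟨ι, G, _, hG, hι⟩ := exists_code_transport (V₂ := Fin 12 → F) hK hE
    (finrank_fin_fun F) (finrank_fin_fun F) hS hdist
  exact hG.exists_set (le_trans
    (Nat.add_le_add_left (size_le Fintype.one_lt_card) _) hι)
end

section
/- There exists a set of 19674269 four-dimensional subspaces of F_2^{12} whose pairwise subspace distance is at least 4; that is, A_2(12,4,4) ≥ 19674269. -/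
namespace SubspaceCode

open Module

/-- The plane `F_2^2`, on which `F_4` acts through `planeMul`. -/
abbrev Plane := ZMod 2 × ZMod 2

/-- The space `F_2^4`. -/
abbrev Quad := Plane × Plane

/-- The field with 16 elements. -/
abbrev K := GaloisField 2 4

/-- The ambient space, of dimension 12 over `F_2`. -/
abbrev Ambient := Quad × Quad × K

/-- Multiplication by `a` in `F_4 = F_2[ω]`, where the pair `(x, y)` stands for `x + y ω`. -/
def planeMul (a : Plane) : Plane →ₗ[ZMod 2] Plane where
  toFun s := (a.1 * s.1 + a.2 * s.2, a.1 * s.2 + a.2 * s.1 + a.2 * s.2)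
  map_add' x y := by ext <;> simp <;> ring
  map_smul' r x := by ext <;> simp <;> ring

/-- The Frobenius map of `F_4`. -/
def planeFrob : Plane →ₗ[ZMod 2] Plane where
  toFun s := (s.1 + s.2, s.2)
  map_add' x y := by ext <;> simp; ring
  map_smul' r x := by ext <;> simp; ring

/-- An automorphism of order 7 of `F_2^4 = F_8 × F_2`. -/
def shift : Quad →ₗ[ZMod 2] Quad where
  toFun v := ((v.2.1, v.1.1 + v.2.1), (v.1.2, v.2.2))
  map_add' x y := by ext <;> simp; ring
  map_smul' r x := by ext <;> simp; ring

/-- Generators of the five lines of a spread of `PG(3,2)`. -/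
def baseLine : Fin 5 → Quad × Quad :=
  ![(((1, 0), (0, 0)), ((0, 1), (0, 0))),
    (((0, 0), (1, 0)), ((0, 1), (0, 1))),
    (((1, 0), (1, 0)), ((0, 0), (0, 1))),
    (((0, 1), (1, 0)), ((1, 0), (0, 1))),
    (((1, 1), (1, 0)), ((1, 1), (0, 1)))]

/-- The lines of a packing of `PG(3,2)`: `line i 0, …, line i 4` form a spread for each of the
seven values of `i`, and these spreads have no common line. -/
def line (i : Fin 7) (j : Fin 5) : Plane →ₗ[ZMod 2] Quad where
  toFun s := shift^[i] (s.1 • (baseLine j).1 + s.2 • (baseLine j).2)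
  map_add' x y := by
    rw [← Module.End.coe_pow, ← map_add]
    congr 1
    simp only [Prod.fst_add, Prod.snd_add, add_smul]
    abel
  map_smul' r x := by
    rw [← Module.End.coe_pow, RingHom.id_apply, ← map_smul]
    simp only [Prod.smul_fst, Prod.smul_snd, smul_add, smul_assoc]

theorem line_injective (i : Fin 7) (j : Fin 5) : Function.Injective (line i j) := by
  refine (injective_iff_map_eq_zero _).2 ?_
  revert i j
  decide +kernel

theorem eq_zero_of_line_eq {i : Fin 7} {j j' : Fin 5} (h : j ≠ j') {s t : Plane}
    (hst : line i j s = line i j' t) : s = 0 := by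
  revert i j j' s t
  decide +kernel

theorem line_basis_notMem_range {i i' : Fin 7} (h : i ≠ i') (j j' : Fin 5) :
    (∀ t, line i j (1, 0) ≠ line i' j' t) ∨ (∀ t, line i j (0, 1) ≠ line i' j' t) := by
  revert i i' j j'
  decide +kernel

theorem planeMul_eq {a a' s : Plane} (h : planeMul a s = planeMul a' s) (ha : a ≠ a') :
    s = 0 := by
  revert a a' s
  decide +kernel

theorem planeMul_eq_frob_add {a a' s t : Plane} (hs : s ≠ 0) (ht : t ≠ 0)
    (h : planeMul a s = planeFrob s + planeMul a' s)
    (h' : planeMul a t = planeFrob t + planeMul a' t) : s = t := by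
  revert a a' s t
  decide +kernel

theorem line_eq_unique {i i' : Fin 7} (h : i ≠ i') {j j' : Fin 5} {s s' t t' : Plane}
    (hs : s ≠ 0) (hs' : s' ≠ 0) (hst : line i j s = line i' j' t)
    (hst' : line i j s' = line i' j' t') : s = s' := by
  by_contra hne
  have key : ∀ s s' : Plane, s ≠ 0 → s' ≠ 0 → s ≠ s' →
      ((1, 0) = s ∨ (1, 0) = s' ∨ (1, 0) = s + s') ∧
        ((0, 1) = s ∨ (0, 1) = s' ∨ (0, 1) = s + s') := by
    decide +kernel
  have mem : ∀ b, (b = s ∨ b = s' ∨ b = s + s') → ∃ t, line i j b = line i' j' t := by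
    rintro b (rfl | rfl | rfl)
    · exact ⟨t, hst⟩
    · exact ⟨t', hst'⟩
    · exact ⟨t + t', by rw [map_add, map_add, hst, hst']⟩
  obtain ⟨h₁, h₂⟩ := key s s' hs hs' hne
  obtain ⟨t₁, ht₁⟩ := mem _ h₁
  obtain ⟨t₂, ht₂⟩ := mem _ h₂
  exact (line_basis_notMem_range h j j').elim (fun H => H t₁ ht₁) (fun H => H t₂ ht₂)

theorem line_add_eq {i : Fin 7} {j j' : Fin 5} (h : j ≠ j') {s s' t t' : Plane}
    (hst : line i j s + line i j' t = line i j s' + line i j' t') : s = s' ∧ t = t' := by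
  have h₀ : line i j (s - s') = line i j' (t' - t) := by
    rw [map_sub, map_sub, sub_eq_sub_iff_add_eq_add, hst, add_comm]
  have hs := eq_zero_of_line_eq h h₀
  have ht := eq_zero_of_line_eq h.symm h₀.symm
  exact ⟨sub_eq_zero.1 hs, (sub_eq_zero.1 ht).symm⟩

theorem card_K : Nat.card K = 16 := by
  rw [GaloisField.card 2 4 (by norm_num)]; norm_num

theorem finrank_K : finrank (ZMod 2) K = 4 := GaloisField.finrank 2 (by norm_num)

theorem finrank_plane : finrank (ZMod 2) Plane = 2 := by simp

theorem finrank_quad : finrank (ZMod 2) Quad = 4 := by simp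

/-- A linear identification of `F_2^4` with the field of 16 elements. -/
noncomputable def quadEquiv : Quad ≃ₗ[ZMod 2] K :=
  LinearEquiv.ofFinrankEq _ _ (by rw [finrank_K, finrank_quad])

theorem exists_scalars : ∃ g : Fin 7 → K, Function.Injective g ∧ ∀ i, g i ≠ 0 := by
  classical
  have : Fintype K := Fintype.ofFinite K
  have hc : Fintype.card (Fin 7) ≤ Fintype.card Kˣ := by
    rw [Fintype.card_units, ← Nat.card_eq_fintype_card (α := K), card_K]
    simp
  obtain ⟨f⟩ := Function.Embedding.nonempty_of_card_le hc
  exact ⟨fun i => f i, fun i j h => f.injective (Units.ext h), fun i => (f i).ne_zero⟩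

/-- Seven distinct nonzero scalars. -/
noncomputable def scalar : Fin 7 → K := exists_scalars.choose

theorem scalar_injective : Function.Injective scalar := exists_scalars.choose_spec.1

theorem scalar_ne_zero (i : Fin 7) : scalar i ≠ 0 := exists_scalars.choose_spec.2 i

/-- The linearized polynomial `c₀ x + c₁ x² + c₂ x⁴`. -/
noncomputable def gabidulin (c : K × K × K) : K →ₗ[ZMod 2] K :=
  AddMonoidHom.toZModLinearMap 2
    { toFun := fun x => c.1 * x + c.2.1 * x ^ 2 + c.2.2 * x ^ 4
      map_zero' := by simp
      map_add' := fun x y => by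
        have h2 : (x + y) ^ 2 = x ^ 2 + y ^ 2 := add_pow_char x y 2
        have h4 : (x + y) ^ 4 = x ^ 4 + y ^ 4 := by
          calc (x + y) ^ 4 = ((x + y) ^ 2) ^ 2 := by rw [← pow_mul]
            _ = x ^ 4 + y ^ 4 := by rw [h2, add_pow_char _ _ 2, ← pow_mul, ← pow_mul]
        rw [h2, h4]
        ring }

theorem gabidulin_apply (c : K × K × K) (x : K) :
    gabidulin c x = c.1 * x + c.2.1 * x ^ 2 + c.2.2 * x ^ 4 := rfl

theorem gabidulin_sub (c d : K × K × K) (x : K) :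
    gabidulin (c - d) x = gabidulin c x - gabidulin d x := by
  simp only [gabidulin_apply, Prod.fst_sub, Prod.snd_sub]
  ring

theorem finrank_le_two_of_card_le {V : Type*} [AddCommGroup V] [Module (ZMod 2) V]
    [Module.Finite (ZMod 2) V] (h : Nat.card V ≤ 4) : finrank (ZMod 2) V ≤ 2 := by
  rw [Module.natCard_eq_pow_finrank (K := ZMod 2), Nat.card_zmod] at h
  exact (Nat.pow_le_pow_iff_right (a := 2) (by norm_num)).1 h

theorem finrank_le_one_of_unique {V : Type*} [AddCommGroup V] [Module (ZMod 2) V]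
    (h : ∀ x y : V, x ≠ 0 → y ≠ 0 → x = y) : finrank (ZMod 2) V ≤ 1 := by
  by_cases hV : ∃ v : V, v ≠ 0
  · obtain ⟨v, hv⟩ := hV
    refine finrank_le_one v fun w => ?_
    by_cases hw : w = 0
    · exact ⟨0, by simp [hw]⟩
    · exact ⟨1, by rw [one_smul, h w v hw hv]⟩
  · push Not at hV
    exact finrank_le_one 0 fun w => ⟨0, by rw [hV w, smul_zero]⟩

theorem finrank_ker_gabidulin {c : K × K × K} (hc : c ≠ 0) :
    finrank (ZMod 2) (LinearMap.ker (gabidulin c)) ≤ 2 := by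
  classical
  refine finrank_le_two_of_card_le ?_
  let p : Polynomial K := .C c.1 * .X + .C c.2.1 * .X ^ 2 + .C c.2.2 * .X ^ 4
  have hp : p ≠ 0 := by
    intro h0
    apply hc
    have h1 := congrArg (fun q => q.coeff 1) h0
    have h2 := congrArg (fun q => q.coeff 2) h0
    have h4 := congrArg (fun q => q.coeff 4) h0
    simp [p, Polynomial.coeff_X_pow] at h1 h2 h4
    ext1
    · exact h1
    · ext1
      · exact h2
      · exact h4
  have hdeg : p.natDegree ≤ 4 := by
    simp only [p]
    compute_degree
  have hsub : (LinearMap.ker (gabidulin c) : Set K) ⊆ p.roots.toFinset := by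
    intro x hx
    have hx' : gabidulin c x = 0 := hx
    rw [gabidulin_apply] at hx'
    simpa [p, hp] using hx'
  calc Nat.card (LinearMap.ker (gabidulin c))
      = (LinearMap.ker (gabidulin c) : Set K).ncard := rfl
    _ ≤ (p.roots.toFinset : Set K).ncard := Set.ncard_le_ncard hsub (Finset.finite_toSet _)
    _ = p.roots.toFinset.card := Set.ncard_coe_finset _
    _ ≤ p.natDegree := (Multiset.toFinset_card_le _).trans (Polynomial.card_roots' p)
    _ ≤ 4 := hdeg

/-- The parameters `x` for which `f x` lies in the range of `f'`. -/
noncomputable def meet (f f' : Quad →ₗ[ZMod 2] Ambient) : Submodule (ZMod 2) Quad :=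
  (LinearMap.range f').comap f

theorem mem_meet {f f' : Quad →ₗ[ZMod 2] Ambient} {x : Quad} :
    x ∈ meet f f' ↔ ∃ y, f x = f' y := by
  simp [meet, eq_comm]

/-- The ranges of `f` and `f'` meet in a subspace of dimension at most two. -/
def SmallMeet (f f' : Quad →ₗ[ZMod 2] Ambient) : Prop :=
  finrank (ZMod 2) ↥(LinearMap.range f ⊓ LinearMap.range f') ≤ 2

theorem SmallMeet.symm {f f' : Quad →ₗ[ZMod 2] Ambient} (h : SmallMeet f f') :
    SmallMeet f' f := by
  rwa [SmallMeet, inf_comm]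

theorem smallMeet_of_finrank {f f' : Quad →ₗ[ZMod 2] Ambient}
    (h : finrank (ZMod 2) (meet f f') ≤ 2) : SmallMeet f f' := by
  rw [SmallMeet, ← Submodule.map_comap_eq]
  exact (Submodule.finrank_map_le f (meet f f')).trans h

theorem finrank_eq_fst_add (R : Submodule (ZMod 2) Quad) :
    finrank (ZMod 2) (R.map (LinearMap.fst (ZMod 2) Plane Plane)) +
      finrank (ZMod 2) (R.comap (LinearMap.inr (ZMod 2) Plane Plane)) =
        finrank (ZMod 2) R := by
  have h := LinearMap.finrank_range_add_finrank_ker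
    ((LinearMap.fst (ZMod 2) Plane Plane).domRestrict R)
  rw [LinearMap.range_domRestrict] at h
  rw [← h]
  congr 1
  refine LinearEquiv.finrank_eq (LinearEquiv.ofBijective
    (LinearMap.codRestrict _ (LinearMap.codRestrict R
      ((LinearMap.inr (ZMod 2) Plane Plane).domRestrict _) fun x => x.2) fun x => ?_) ⟨?_, ?_⟩)
  · rfl
  · intro x y hxy
    have := congrArg (fun z => z.1.1.2) hxy
    exact Subtype.ext this
  · rintro ⟨⟨⟨s, t⟩, hR⟩, hs⟩
    have hs' : s = 0 := hs
    subst hs'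
    exact ⟨⟨t, hR⟩, rfl⟩

theorem smallMeet_of_fst_eq_zero {f f' : Quad →ₗ[ZMod 2] Ambient}
    (h : ∀ x y, f x = f' y → x.1 = 0) : SmallMeet f f' := by
  refine smallMeet_of_finrank ?_
  rw [← finrank_eq_fst_add]
  have h₁ : (meet f f').map (LinearMap.fst (ZMod 2) Plane Plane) = ⊥ := by
    rw [eq_bot_iff]
    rintro _ ⟨x, hx, rfl⟩
    obtain ⟨y, hy⟩ := mem_meet.1 hx
    exact h x y hy
  rw [h₁, finrank_bot, zero_add]
  exact (Submodule.finrank_le _).trans finrank_plane.le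

theorem smallMeet_of_snd_eq_zero {f f' : Quad →ₗ[ZMod 2] Ambient}
    (h : ∀ t y, f (0, t) = f' y → t = 0) : SmallMeet f f' := by
  refine smallMeet_of_finrank ?_
  rw [← finrank_eq_fst_add]
  have h₂ : (meet f f').comap (LinearMap.inr (ZMod 2) Plane Plane) = ⊥ := by
    rw [eq_bot_iff]
    intro t ht
    obtain ⟨y, hy⟩ := mem_meet.1 ht
    exact h t y hy
  rw [h₂, finrank_bot, add_zero]
  exact (Submodule.finrank_le _).trans finrank_plane.le

theorem smallMeet_of_unique {f f' : Quad →ₗ[ZMod 2] Ambient}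
    (h₁ : ∀ x y x' y', f x = f' y → f x' = f' y' → x.1 ≠ 0 → x'.1 ≠ 0 → x.1 = x'.1)
    (h₂ : ∀ t y t' y', f (0, t) = f' y → f (0, t') = f' y' → t ≠ 0 → t' ≠ 0 → t = t') :
    SmallMeet f f' := by
  refine smallMeet_of_finrank ?_
  rw [← finrank_eq_fst_add]
  refine add_le_add (b := 1) (d := 1) (finrank_le_one_of_unique ?_) (finrank_le_one_of_unique ?_)
  · rintro ⟨_, x, hx, rfl⟩ ⟨_, x', hx', rfl⟩ h0 h0'
    obtain ⟨y, hy⟩ := mem_meet.1 hx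
    obtain ⟨y', hy'⟩ := mem_meet.1 hx'
    exact Subtype.ext (h₁ x y x' y' hy hy' (fun h => h0 (Subtype.ext h))
      fun h => h0' (Subtype.ext h))
  · rintro ⟨t, ht⟩ ⟨t', ht'⟩ h0 h0'
    obtain ⟨y, hy⟩ := mem_meet.1 ht
    obtain ⟨y', hy'⟩ := mem_meet.1 ht'
    exact Subtype.ext (h₂ t y t' y' hy hy' (fun h => h0 (Subtype.ext h))
      fun h => h0' (Subtype.ext h))

theorem smallMeet_of_gabidulin {f f' : Quad →ₗ[ZMod 2] Ambient} {c d : K × K × K} (hcd : c ≠ d)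
    (h : ∀ x y, f x = f' y → gabidulin c (quadEquiv x) = gabidulin d (quadEquiv x)) :
    SmallMeet f f' := by
  refine smallMeet_of_finrank ?_
  have hle : (meet f f').map (quadEquiv : Quad →ₗ[ZMod 2] K) ≤
      LinearMap.ker (gabidulin (c - d)) := by
    rintro _ ⟨x, hx, rfl⟩
    obtain ⟨y, hy⟩ := mem_meet.1 hx
    exact LinearMap.mem_ker.2 (by rw [gabidulin_sub]; exact sub_eq_zero.2 (h x y hy))
  have hfin := LinearEquiv.finrank_map_eq quadEquiv (meet f f')
  rw [← hfin]
  exact (Submodule.finrank_mono hle).trans (finrank_ker_gabidulin (sub_ne_zero.2 hcd))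

/-- Indices of the lifted Gabidulin codewords. -/
abbrev IndexA := (K × K × K) × (K × K × K)

/-- Indices `(i, j, k, a, c)` of the codewords made from two lines `j`, `k` of the `i`-th spread. -/
abbrev IndexB := Fin 7 × Fin 5 × Fin 5 × Plane × K × K × K

/-- Indices `(i, j, k, w, a, c)` of the codewords made from the line `j` and a point `w` of the
line `k` of the `i`-th spread. -/
abbrev IndexC := Fin 7 × Fin 5 × Fin 5 × {w : Plane // w ≠ 0} × Plane × K

/-- A lifted Gabidulin codeword. -/
noncomputable def codeA (c d : K × K × K) : Quad →ₗ[ZMod 2] Ambient :=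
  LinearMap.id.prod ((quadEquiv.symm.toLinearMap ∘ₗ gabidulin c ∘ₗ quadEquiv.toLinearMap).prod
    (gabidulin d ∘ₗ quadEquiv.toLinearMap))

/-- A codeword meeting `0 × F_2^4 × K` in a line disjoint from `0 × 0 × K`. -/
noncomputable def codeB (i : Fin 7) (j k : Fin 5) (a : Plane) (c : K × K × K) :
    Quad →ₗ[ZMod 2] Ambient :=
  (line i j ∘ₗ LinearMap.fst _ _ _).prod
    (((line i (k + 1) ∘ₗ planeMul a).coprod (line i k)).prod
      (gabidulin c ∘ₗ quadEquiv.toLinearMap))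

/-- The point in which a codeword of the third kind meets `0 × 0 × K`. -/
noncomputable def point (i : Fin 7) (k : Fin 5) (w : Plane) : K :=
  scalar i * quadEquiv (line i k w)

/-- A codeword meeting `0 × 0 × K` in the point `point i k w`. -/
noncomputable def codeC (i : Fin 7) (j k : Fin 5) (w a : Plane) (c : K) :
    Quad →ₗ[ZMod 2] Ambient :=
  (line i j ∘ₗ LinearMap.fst _ _ _).prod
    (((line i (k + 1) ∘ₗ (planeFrob + planeMul a)).coprod
        (LinearMap.toSpanSingleton _ _ (line i k w) ∘ₗ LinearMap.fst _ _ _)).prod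
      (LinearMap.mulLeft (ZMod 2) c ∘ₗ quadEquiv.toLinearMap ∘ₗ
          LinearMap.id.prodMap ((LinearMap.inl _ _ _) ∘ₗ LinearMap.fst _ _ _) +
        LinearMap.toSpanSingleton _ _ (point i k w) ∘ₗ LinearMap.snd _ _ _ ∘ₗ
          LinearMap.snd _ _ _))

theorem codeA_apply (c d : K × K × K) (x : Quad) :
    codeA c d x = (x, quadEquiv.symm (gabidulin c (quadEquiv x)), gabidulin d (quadEquiv x)) :=
  rfl

theorem codeB_apply (i : Fin 7) (j k : Fin 5) (a : Plane) (c : K × K × K) (x : Quad) :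
    codeB i j k a c x =
      (line i j x.1, line i (k + 1) (planeMul a x.1) + line i k x.2,
        gabidulin c (quadEquiv x)) :=
  rfl

theorem codeC_apply (i : Fin 7) (j k : Fin 5) (w a : Plane) (c : K) (x : Quad) :
    codeC i j k w a c x =
      (line i j x.1, line i (k + 1) (planeFrob x.1 + planeMul a x.1) + line i k (x.2.1 • w),
        c * quadEquiv (x.1, (x.2.1, 0)) + x.2.2 • point i k w) := by
  rw [map_smul]
  rfl

theorem add_one_ne (k : Fin 5) : k + 1 ≠ k := by
  revert k
  decide

theorem eq_one_of_ne_zero {m : ZMod 2} (h : m ≠ 0) : m = 1 := by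
  revert m
  decide

theorem line_eq_zero {i : Fin 7} {j : Fin 5} {s : Plane} (h : line i j s = 0) : s = 0 :=
  line_injective i j (by rw [h, map_zero])

theorem line_ne_zero {i : Fin 7} {j : Fin 5} {w : Plane} (hw : w ≠ 0) : line i j w ≠ 0 :=
  fun h => hw (line_eq_zero h)

theorem point_ne_zero {i : Fin 7} {k : Fin 5} {w : Plane} (hw : w ≠ 0) : point i k w ≠ 0 :=
  mul_ne_zero (scalar_ne_zero i)
    ((map_ne_zero_iff _ quadEquiv.injective).2 (line_ne_zero hw))

theorem codeA_injective (c d : K × K × K) : Function.Injective (codeA c d) := by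
  intro x y h
  exact congrArg Prod.fst h

theorem codeB_injective (i : Fin 7) (j k : Fin 5) (a : Plane) (c : K × K × K) :
    Function.Injective (codeB i j k a c) := by
  refine (injective_iff_map_eq_zero _).2 fun x h => ?_
  rw [codeB_apply] at h
  obtain ⟨h₁, h⟩ := Prod.mk_eq_zero.1 h
  obtain ⟨h₂, -⟩ := Prod.mk_eq_zero.1 h
  have hs := line_eq_zero h₁
  rw [hs, map_zero, map_zero, zero_add] at h₂
  exact Prod.ext hs (line_eq_zero h₂)

theorem codeC_injective (i : Fin 7) (j k : Fin 5) {w : Plane} (hw : w ≠ 0) (a : Plane) (c : K) :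
    Function.Injective (codeC i j k w a c) := by
  refine (injective_iff_map_eq_zero _).2 fun x h => ?_
  rw [codeC_apply] at h
  obtain ⟨h₁, h⟩ := Prod.mk_eq_zero.1 h
  obtain ⟨h₂, h₃⟩ := Prod.mk_eq_zero.1 h
  have hs := line_eq_zero h₁
  rw [hs, map_zero, map_zero, add_zero, map_zero, zero_add] at h₂
  have hn := (smul_eq_zero.1 (line_eq_zero h₂)).resolve_right hw
  rw [hs, hn, ← Prod.zero_eq_mk, ← Prod.zero_eq_mk, map_zero, mul_zero, zero_add] at h₃
  have hm := (smul_eq_zero.1 h₃).resolve_right (point_ne_zero hw)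
  exact Prod.ext hs (Prod.ext hn hm)

theorem smallMeet_codeA_of_line {f : Quad →ₗ[ZMod 2] Ambient} (hf : Function.Injective f)
    {i : Fin 7} {j : Fin 5} (h : ∀ x, (f x).1 = line i j x.1) (c d : K × K × K) :
    SmallMeet f (codeA c d) := by
  refine smallMeet_of_snd_eq_zero fun t y hty => ?_
  have hy : y = 0 := by
    have h₁ := congrArg Prod.fst hty
    rw [h, map_zero] at h₁
    exact h₁.symm
  rw [hy, map_zero] at hty
  exact congrArg Prod.snd ((injective_iff_map_eq_zero f).1 hf _ hty)

theorem smallMeet_codeA_codeA {p q : IndexA} (h : p ≠ q) :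
    SmallMeet (codeA p.1 p.2) (codeA q.1 q.2) := by
  by_cases h₁ : p.1 = q.1
  · have h₂ : p.2 ≠ q.2 := fun h₂ => h (Prod.ext h₁ h₂)
    refine smallMeet_of_gabidulin h₂ fun x y hxy => ?_
    simp only [codeA_apply, Prod.mk.injEq] at hxy
    obtain ⟨rfl, -, hxy⟩ := hxy
    exact hxy
  · refine smallMeet_of_gabidulin h₁ fun x y hxy => ?_
    simp only [codeA_apply, Prod.mk.injEq] at hxy
    obtain ⟨rfl, hxy, -⟩ := hxy
    exact quadEquiv.symm.injective hxy

theorem smallMeet_of_line_ne {f f' : Quad →ₗ[ZMod 2] Ambient} {i : Fin 7} {j j' : Fin 5}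
    (h : ∀ x, (f x).1 = line i j x.1) (h' : ∀ x, (f' x).1 = line i j' x.1) (hj : j ≠ j') :
    SmallMeet f f' := by
  refine smallMeet_of_fst_eq_zero fun x y hxy => ?_
  have h₁ := congrArg Prod.fst hxy
  rw [h, h'] at h₁
  exact eq_zero_of_line_eq hj h₁

theorem smallMeet_of_spread_ne {f f' : Quad →ₗ[ZMod 2] Ambient} {i i' : Fin 7} {j j' : Fin 5}
    (h : ∀ x, (f x).1 = line i j x.1) (h' : ∀ x, (f' x).1 = line i' j' x.1) (hi : i ≠ i')
    (h₀ : ∀ t u t' u', f (0, t) = f' (0, u) → f (0, t') = f' (0, u') → t ≠ 0 → t' ≠ 0 → t = t') :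
    SmallMeet f f' := by
  refine smallMeet_of_unique (fun x y x' y' hxy hxy' hs hs' => ?_)
    fun t y t' y' hty hty' ht ht' => ?_
  · have h₁ := congrArg Prod.fst hxy
    have h₂ := congrArg Prod.fst hxy'
    rw [h, h'] at h₁ h₂
    exact line_eq_unique hi hs hs' h₁ h₂
  · have key : ∀ t y, f (0, t) = f' y → y = (0, y.2) := fun t y hty => by
      have h₁ := congrArg Prod.fst hty
      rw [h, h', map_zero] at h₁
      exact Prod.ext (line_eq_zero h₁.symm) rfl
    rw [key t y hty] at hty
    rw [key t' y' hty'] at hty'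
    exact h₀ _ _ _ _ hty hty' ht ht'

theorem smallMeet_codeB_codeB {p q : IndexB} (h : p ≠ q) :
    SmallMeet (codeB p.1 p.2.1 p.2.2.1 p.2.2.2.1 p.2.2.2.2)
      (codeB q.1 q.2.1 q.2.2.1 q.2.2.2.1 q.2.2.2.2) := by
  obtain ⟨i, j, k, a, c⟩ := p
  obtain ⟨i', j', k', a', c'⟩ := q
  dsimp only
  by_cases hi : i = i'
  swap
  · refine smallMeet_of_spread_ne (i := i) (i' := i') (fun x => rfl) (fun x => rfl) hi ?_
    intro t u t' u' htu htu' ht ht'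
    simp only [codeB_apply, Prod.mk.injEq, map_zero, zero_add] at htu htu'
    exact line_eq_unique hi ht ht' htu.2.1 htu'.2.1
  subst hi
  by_cases hj : j = j'
  swap
  · exact smallMeet_of_line_ne (i := i) (fun x => rfl) (fun x => rfl) hj
  subst hj
  by_cases hk : k = k'
  swap
  · refine smallMeet_of_snd_eq_zero fun t y hty => ?_
    simp only [codeB_apply, Prod.mk.injEq, map_zero, zero_add] at hty
    obtain ⟨h₁, h₂, -⟩ := hty
    rw [line_eq_zero h₁.symm, map_zero, map_zero, zero_add] at h₂
    exact eq_zero_of_line_eq hk h₂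
  subst hk
  have key : ∀ x y, codeB i j k a c x = codeB i j k a' c' y →
      x.1 = y.1 ∧ planeMul a x.1 = planeMul a' x.1 ∧ x.2 = y.2 := by
    intro x y hxy
    simp only [codeB_apply, Prod.mk.injEq] at hxy
    have h₁ := line_injective i j hxy.1
    have h₂ := line_add_eq (add_one_ne k) hxy.2.1
    exact ⟨h₁, by rw [h₂.1, h₁], h₂.2⟩
  by_cases ha : a = a'
  swap
  · exact smallMeet_of_fst_eq_zero fun x y hxy => planeMul_eq (key x y hxy).2.1 ha
  subst ha
  have hc : c ≠ c' := by
    rintro rfl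
    exact h rfl
  refine smallMeet_of_gabidulin hc fun x y hxy => ?_
  obtain ⟨h₁, -, h₂⟩ := key x y hxy
  obtain rfl : x = y := Prod.ext h₁ h₂
  exact congrArg (fun z => z.2.2) hxy

theorem smallMeet_codeB_codeC (p : IndexB) (q : IndexC) :
    SmallMeet (codeB p.1 p.2.1 p.2.2.1 p.2.2.2.1 p.2.2.2.2)
      (codeC q.1 q.2.1 q.2.2.1 q.2.2.2.1 q.2.2.2.2.1 q.2.2.2.2.2) := by
  obtain ⟨i, j, k, a, c⟩ := p
  obtain ⟨i', j', k', ⟨w, hw⟩, a', c'⟩ := q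
  dsimp only
  have key : ∀ t u, codeB i j k a c (0, t) = codeC i' j' k' w a' c' (0, u) → t ≠ 0 →
      line i k t = line i' k' w := by
    intro t u htu ht
    simp only [codeB_apply, codeC_apply, Prod.mk.injEq, map_zero, zero_add] at htu
    have hu : u.1 ≠ 0 := by
      intro hu
      rw [hu, zero_smul, map_zero] at htu
      exact ht (line_eq_zero htu.2.1)
    rw [htu.2.1, eq_one_of_ne_zero hu, one_smul]
  have key' : ∀ t u t' u', codeB i j k a c (0, t) = codeC i' j' k' w a' c' (0, u) →
      codeB i j k a c (0, t') = codeC i' j' k' w a' c' (0, u') → t ≠ 0 → t' ≠ 0 → t = t' :=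
    fun t u t' u' h h' ht ht' =>
      line_injective i k ((key t u h ht).trans (key t' u' h' ht').symm)
  by_cases hi : i = i'
  swap
  · exact smallMeet_of_spread_ne (i := i) (i' := i') (fun x => rfl) (fun x => rfl) hi key'
  subst hi
  by_cases hj : j = j'
  swap
  · exact smallMeet_of_line_ne (i := i) (fun x => rfl) (fun x => rfl) hj
  subst hj
  have hfst : ∀ x y, codeB i j k a c x = codeC i j k' w a' c' y → x.1 = y.1 :=
    fun x y hxy => line_injective i j (congrArg Prod.fst hxy)
  have hzero : ∀ t y, codeB i j k a c (0, t) = codeC i j k' w a' c' y → y = (0, y.2) :=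
    fun t y hty => Prod.ext (hfst _ _ hty).symm rfl
  by_cases hk : k = k'
  swap
  · refine smallMeet_of_snd_eq_zero fun t y hty => ?_
    by_contra ht
    rw [hzero t y hty] at hty
    exact ht (eq_zero_of_line_eq hk (key _ _ hty ht))
  subst hk
  have hmul : ∀ x y, codeB i j k a c x = codeC i j k w a' c' y →
      planeMul a x.1 = planeFrob x.1 + planeMul a' x.1 := by
    intro x y hxy
    have h₁ := hfst x y hxy
    simp only [codeB_apply, codeC_apply, Prod.mk.injEq] at hxy
    rw [h₁] at hxy ⊢
    exact (line_add_eq (add_one_ne k) hxy.2.1).1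
  refine smallMeet_of_unique (fun x y x' y' hxy hxy' hs hs' => ?_)
    fun t y t' y' hty hty' ht ht' => ?_
  · exact planeMul_eq_frob_add hs hs' (hmul x y hxy) (hmul x' y' hxy')
  · rw [hzero t y hty] at hty
    rw [hzero t' y' hty'] at hty'
    exact key' _ _ _ _ hty hty' ht ht'

theorem eq_zero_of_smul_eq_smul {V : Type*} [AddCommGroup V] [Module (ZMod 2) V] {x y : V}
    (hx : x ≠ 0) (hxy : x ≠ y) {m n : ZMod 2} (h : m • x = n • y) : m = 0 := by
  by_contra hm
  rw [eq_one_of_ne_zero hm, one_smul] at h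
  by_cases hn : n = 0
  · rw [hn, zero_smul] at h
    exact hx h
  · rw [eq_one_of_ne_zero hn, one_smul] at h
    exact hxy h

theorem codeC_meet_point_ne {i i' : Fin 7} {j j' k k' : Fin 5} {w w' a a' : Plane} {c c' : K}
    (hw : w ≠ 0) (hp : point i k w ≠ point i' k' w') {t u : Plane}
    (h : codeC i j k w a c (0, t) = codeC i' j' k' w' a' c' (0, u)) (ht : t.1 = 0)
    (hu : u.1 = 0) : t = 0 := by
  simp only [codeC_apply, Prod.mk.injEq, ht, hu, ← Prod.zero_eq_mk, map_zero, mul_zero,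
    zero_add] at h
  exact Prod.ext ht (eq_zero_of_smul_eq_smul (point_ne_zero hw) hp h.2.2)

theorem codeC_meet_line {i i' : Fin 7} {j j' k k' : Fin 5} {w w' a a' : Plane} {c c' : K}
    {t u : Plane} (h : codeC i j k w a c (0, t) = codeC i' j' k' w' a' c' (0, u)) :
    t.1 • line i k w = u.1 • line i' k' w' := by
  simp only [codeC_apply, Prod.mk.injEq, map_zero, zero_add, map_smul] at h
  exact h.2.1

theorem smallMeet_codeC_codeC {p q : IndexC} (h : p ≠ q) :
    SmallMeet (codeC p.1 p.2.1 p.2.2.1 p.2.2.2.1 p.2.2.2.2.1 p.2.2.2.2.2)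
      (codeC q.1 q.2.1 q.2.2.1 q.2.2.2.1 q.2.2.2.2.1 q.2.2.2.2.2) := by
  obtain ⟨i, j, k, ⟨w, hw⟩, a, c⟩ := p
  obtain ⟨i', j', k', ⟨w', hw'⟩, a', c'⟩ := q
  dsimp only
  by_cases hi : i = i'
  swap
  · refine smallMeet_of_spread_ne (i := i) (i' := i') (fun x => rfl) (fun x => rfl) hi ?_
    intro t u t' u' htu htu' ht ht'
    by_cases hq : line i k w = line i' k' w'
    · have hp : point i k w ≠ point i' k' w' := by
        intro hp
        rw [point, point, hq] at hp
        exact hi (scalar_injective (mul_right_cancel₀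
          ((map_ne_zero_iff _ quadEquiv.injective).2 (line_ne_zero hw')) hp))
      have hfst : ∀ t u, codeC i j k w a c (0, t) = codeC i' j' k' w' a' c' (0, u) →
          t.1 = u.1 := by
        intro t u htu
        have h₁ := codeC_meet_line htu
        rw [hq] at h₁
        exact smul_left_injective _ (line_ne_zero hw') h₁
      have hone : ∀ t u, codeC i j k w a c (0, t) = codeC i' j' k' w' a' c' (0, u) → t ≠ 0 →
          t.1 = 1 := by
        intro t u htu ht
        refine eq_one_of_ne_zero fun h0 => ht ?_
        exact codeC_meet_point_ne hw hp htu h0 ((hfst t u htu).symm.trans h0)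
      have hsub : codeC i j k w a c (0, t - t') = codeC i' j' k' w' a' c' (0, u - u') := by
        have hmk : ∀ v v' : Plane, ((0, v - v') : Quad) = (0, v) - (0, v') :=
          fun v v' => Prod.ext (sub_zero _).symm rfl
        rw [hmk, hmk, map_sub, map_sub, htu, htu']
      have ht1 : (t - t').1 = 0 := by
        rw [Prod.fst_sub, hone t u htu ht, hone t' u' htu' ht', sub_self]
      exact sub_eq_zero.1
        (codeC_meet_point_ne hw hp hsub ht1 ((hfst _ _ hsub).symm.trans ht1))
    · have hsnd : ∀ t u, codeC i j k w a c (0, t) = codeC i' j' k' w' a' c' (0, u) → t ≠ 0 →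
          t = (0, 1) := by
        intro t u htu ht
        have h0 := eq_zero_of_smul_eq_smul (line_ne_zero hw) hq (codeC_meet_line htu)
        exact Prod.ext h0 (eq_one_of_ne_zero fun h1 => ht (Prod.ext h0 h1))
      rw [hsnd t u htu ht, hsnd t' u' htu' ht']
  subst hi
  by_cases hj : j = j'
  swap
  · exact smallMeet_of_line_ne (i := i) (fun x => rfl) (fun x => rfl) hj
  subst hj
  have hfst : ∀ x y, codeC i j k w a c x = codeC i j k' w' a' c' y → x.1 = y.1 :=
    fun x y hxy => line_injective i j (congrArg Prod.fst hxy)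
  by_cases hq : line i k w = line i k' w'
  swap
  · refine smallMeet_of_snd_eq_zero fun t y hty => ?_
    obtain ⟨s, u⟩ := y
    obtain rfl : 0 = s := hfst _ _ hty
    have hp : point i k w ≠ point i k' w' := fun hp =>
      hq (quadEquiv.injective (mul_left_cancel₀ (scalar_ne_zero i) hp))
    exact codeC_meet_point_ne hw hp hty
      (eq_zero_of_smul_eq_smul (line_ne_zero hw) hq (codeC_meet_line hty))
      (eq_zero_of_smul_eq_smul (line_ne_zero hw') (Ne.symm hq) (codeC_meet_line hty).symm)
  obtain rfl : k = k' := by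
    by_contra hk
    exact hw (eq_zero_of_line_eq hk hq)
  obtain rfl : w = w' := line_injective i k hq
  have key : ∀ x y, codeC i j k w a c x = codeC i j k w a' c' y →
      planeMul a x.1 = planeMul a' x.1 ∧ x.2.1 = y.2.1 := by
    intro x y hxy
    have h₁ := hfst x y hxy
    simp only [codeC_apply, Prod.mk.injEq] at hxy
    rw [h₁] at hxy ⊢
    have h₂ := line_add_eq (add_one_ne k) hxy.2.1
    exact ⟨add_left_cancel h₂.1, smul_left_injective _ hw h₂.2⟩
  by_cases ha : a = a'
  swap
  · exact smallMeet_of_fst_eq_zero fun x y hxy => planeMul_eq (key x y hxy).1 ha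
  subst ha
  have hc : c - c' ≠ 0 := by
    intro hc
    rw [sub_eq_zero.1 hc] at h
    exact h rfl
  have hmul : ∀ x y, codeC i j k w a c x = codeC i j k w a c' y → (x.1, x.2.1) ≠ 0 →
      (c - c') * quadEquiv (x.1, (x.2.1, 0)) = point i k w := by
    intro x y hxy hx
    have h₁ := hfst x y hxy
    have h₂ := (key x y hxy).2
    have h₃ := congrArg (fun z => z.2.2) hxy
    simp only [codeC_apply, ← h₁, ← h₂] at h₃
    have h₄ : (c - c') * quadEquiv (x.1, (x.2.1, 0)) = (y.2.2 - x.2.2) • point i k w := by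
      rw [sub_mul, sub_smul, sub_eq_sub_iff_add_eq_add, h₃, add_comm]
    have h₅ : y.2.2 - x.2.2 ≠ 0 := by
      intro h0
      rw [h0, zero_smul] at h₄
      have h₆ := (mul_eq_zero.1 h₄).resolve_left hc
      obtain ⟨h₇, h₈⟩ := Prod.mk_eq_zero.1 ((LinearEquiv.map_eq_zero_iff _).1 h₆)
      exact hx (Prod.ext h₇ (Prod.mk_eq_zero.1 h₈).1)
    rw [h₄, eq_one_of_ne_zero h₅, one_smul]
  have hunique : ∀ x y x' y', codeC i j k w a c x = codeC i j k w a c' y →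
      codeC i j k w a c x' = codeC i j k w a c' y' → (x.1, x.2.1) ≠ 0 → (x'.1, x'.2.1) ≠ 0 →
      x.1 = x'.1 ∧ x.2.1 = x'.2.1 := by
    intro x y x' y' hxy hxy' hx hx'
    have h₁ := quadEquiv.injective
      (mul_left_cancel₀ hc ((hmul x y hxy hx).trans (hmul x' y' hxy' hx').symm))
    simp only [Prod.mk.injEq, and_true] at h₁
    exact h₁
  by_cases hs : ∀ x y, codeC i j k w a c x = codeC i j k w a c' y → x.1 = 0
  · exact smallMeet_of_fst_eq_zero hs
  push Not at hs
  obtain ⟨x₀, y₀, hxy₀, hx₀⟩ := hs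
  have hx₀' : (x₀.1, x₀.2.1) ≠ 0 := fun h0 => hx₀ (congrArg Prod.fst h0)
  refine smallMeet_of_unique (fun x y x' y' hxy hxy' hs hs' => ?_)
    fun t y t' y' hty hty' ht ht' => ?_
  · exact (hunique x y x' y' hxy hxy' (fun h0 => hs (congrArg Prod.fst h0))
      fun h0 => hs' (congrArg Prod.fst h0)).1
  · have hsnd : ∀ t y, codeC i j k w a c (0, t) = codeC i j k w a c' y → t ≠ 0 → t = (0, 1) := by
      intro t y hty ht
      have h0 : t.1 = 0 := by
        by_contra h0
        exact hx₀ (hunique (0, t) y x₀ y₀ hty hxy₀ (fun h' => h0 (congrArg Prod.snd h'))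
          hx₀').1.symm
      exact Prod.ext h0 (eq_one_of_ne_zero fun h1 => ht (Prod.ext h0 h1))
    rw [hsnd t y hty ht, hsnd t' y' hty' ht']

/-- The code, as a family of injective parametrizations of its members. -/
noncomputable def code : IndexA ⊕ IndexB ⊕ IndexC → Quad →ₗ[ZMod 2] Ambient
  | .inl p => codeA p.1 p.2
  | .inr (.inl p) => codeB p.1 p.2.1 p.2.2.1 p.2.2.2.1 p.2.2.2.2
  | .inr (.inr p) => codeC p.1 p.2.1 p.2.2.1 p.2.2.2.1 p.2.2.2.2.1 p.2.2.2.2.2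

theorem code_injective (p : IndexA ⊕ IndexB ⊕ IndexC) : Function.Injective (code p) := by
  rcases p with p | p | p
  · exact codeA_injective _ _
  · exact codeB_injective _ _ _ _ _
  · exact codeC_injective _ _ _ p.2.2.2.1.2 _ _

theorem smallMeet_code {p q : IndexA ⊕ IndexB ⊕ IndexC} (h : p ≠ q) :
    SmallMeet (code p) (code q) := by
  have hBA : ∀ (p : IndexB) (q : IndexA), SmallMeet (code (.inr (.inl p))) (code (.inl q)) :=
    fun p q => smallMeet_codeA_of_line (i := p.1) (j := p.2.1) (code_injective _)
      (fun x => rfl) _ _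
  have hCA : ∀ (p : IndexC) (q : IndexA), SmallMeet (code (.inr (.inr p))) (code (.inl q)) :=
    fun p q => smallMeet_codeA_of_line (i := p.1) (j := p.2.1) (code_injective _)
      (fun x => rfl) _ _
  rcases p with p | p | p <;> rcases q with q | q | q
  · exact smallMeet_codeA_codeA fun hpq => h (by rw [hpq])
  · exact (hBA q p).symm
  · exact (hCA q p).symm
  · exact hBA p q
  · exact smallMeet_codeB_codeB fun hpq => h (by rw [hpq])
  · exact smallMeet_codeB_codeC p q
  · exact hCA p q
  · exact (smallMeet_codeB_codeC q p).symm
  · exact smallMeet_codeC_codeC fun hpq => h (by rw [hpq])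

theorem card_index : Nat.card (IndexA ⊕ IndexB ⊕ IndexC) = 19678016 := by
  have hP : Nat.card Plane = 4 := by simp
  have hw : Nat.card {w : Plane // w ≠ 0} = 3 := by
    rw [Nat.card_eq_fintype_card]
    decide
  rw [Nat.card_sum, Nat.card_sum]
  simp only [IndexA, IndexB, IndexC, Nat.card_prod, card_K, hw, Nat.card_fin, hP]

theorem four_le_subspaceDist {F V : Type*} [Field F] [AddCommGroup V] [Module F V]
    [FiniteDimensional F V] {X Y : Submodule F V} (hX : finrank F X = 4) (hY : finrank F Y = 4)
    (h : finrank F ↥(X ⊓ Y) ≤ 2) : 4 ≤ subspaceDist X Y := by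
  have := Submodule.finrank_sup_add_finrank_inf_eq X Y
  rw [subspaceDist]
  omega

/-- An identification of the ambient space with `F_2^12`. -/
noncomputable def ambientEquiv : Ambient ≃ₗ[ZMod 2] (Fin 12 → ZMod 2) :=
  LinearEquiv.ofFinrankEq _ _ (by
    rw [finrank_prod (M := Quad), finrank_prod (M := Quad), finrank_quad, finrank_K,
      finrank_fin_fun])

/-- The members of the code as subspaces of `F_2^12`. -/
noncomputable def codeword (p : IndexA ⊕ IndexB ⊕ IndexC) :
    Submodule (ZMod 2) (Fin 12 → ZMod 2) :=
  (LinearMap.range (code p)).map ambientEquiv.toLinearMap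

theorem finrank_codeword (p : IndexA ⊕ IndexB ⊕ IndexC) :
    finrank (ZMod 2) (codeword p) = 4 := by
  have h := LinearEquiv.finrank_map_eq ambientEquiv (LinearMap.range (code p))
  rw [LinearMap.finrank_range_of_inj (code_injective p), finrank_quad] at h
  exact h

theorem finrank_codeword_inf {p q : IndexA ⊕ IndexB ⊕ IndexC} (h : p ≠ q) :
    finrank (ZMod 2) ↥(codeword p ⊓ codeword q) ≤ 2 := by
  rw [codeword, codeword, ← Submodule.map_inf _ ambientEquiv.injective]
  exact (Submodule.finrank_map_le _ _).trans (smallMeet_code h)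

theorem codeword_injective : Function.Injective codeword := by
  intro p q hpq
  by_contra h
  have h₂ := finrank_codeword_inf h
  rw [hpq, inf_idem, finrank_codeword] at h₂
  omega

end SubspaceCode

theorem statement9 :
    ∃ S : Set (Submodule (ZMod 2) (Fin 12 → ZMod 2)),
      S.ncard = 19674269 ∧
      (∀ X ∈ S, Module.finrank (ZMod 2) ↥X = 4) ∧
      (∀ X ∈ S, ∀ Y ∈ S, X ≠ Y → 4 ≤ subspaceDist X Y) := by
  have hcard : (Set.range SubspaceCode.codeword).ncard = 19678016 := by
    rw [← SubspaceCode.card_index]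
    exact Set.ncard_range_of_injective SubspaceCode.codeword_injective
  obtain ⟨S, hS, hSc⟩ := Set.exists_subset_card_eq (s := Set.range SubspaceCode.codeword)
    (n := 19674269) (by rw [hcard]; norm_num)
  refine ⟨S, hSc, fun X hX => ?_, fun X hX Y hY hXY => ?_⟩
  · obtain ⟨p, rfl⟩ := hS hX
    exact SubspaceCode.finrank_codeword p
  · obtain ⟨p, rfl⟩ := hS hX
    obtain ⟨q, rfl⟩ := hS hY
    exact SubspaceCode.four_le_subspaceDist (SubspaceCode.finrank_codeword p)
      (SubspaceCode.finrank_codeword q)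
      (SubspaceCode.finrank_codeword_inf fun hpq => hXY (by rw [hpq]))
end

section
/- Let q be a prime power and suppose there exists a set of N four-dimensional subspaces of F_q^8 whose pairwise subspace distance is at least 4. Then there exists a set of N·q^{18} + (q^{18} + 2q^{16} + 3q^{15} + 5q^{14} + q^{13} + 4q^{12} + 6q^{11} + 10q^{10} + 8q^9 + 8q^8 + 4q^7 + 2q^6 + q^5 + 2q^4 + q^2 + 1) four-dimensional subspaces of F_q^{14} whose pairwise subspace distance is at least 4; in other words, A_q(14,4,4) ≥ A_q(8,4,4)·q^{18} + q^{18} + 2q^{16} + 3q^{15} + 5q^{14} + q^{13} + 4q^{12} + 6q^{11} + 10q^{10} + 8q^9 + 8q^8 + 4q^7 + 2q^6 + q^5 + 2q^4 + q^2 + 1. -/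
open Module

theorem exists_field_extension (F : Type) [Field F] [Finite F] (n : ℕ) (hn : n ≠ 0) :
    ∃ (K : Type) (_ : Field K) (_ : Algebra F K), finrank F K = n := by
  obtain ⟨p, hp⟩ := CharP.exists F
  have : Fact p.Prime := ⟨CharP.char_is_prime F p⟩
  have : NeZero n := ⟨hn⟩
  exact ⟨FiniteField.Extension F p n, inferInstance, inferInstance,
    FiniteField.finrank_extension F p n⟩

theorem exists_rankCode {F V U : Type} [Field F] [Finite F] [AddCommGroup V] [Module F V]
    [AddCommGroup U] [Module F U] [FiniteDimensional F V] [FiniteDimensional F U]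
    (hV : 0 < finrank F V) (hVU : finrank F V ≤ finrank F U) :
    ∃ C : Set (V →ₗ[F] U), C.ncard = Nat.card F ^ (finrank F U * (finrank F V - 1)) ∧
      ∀ f ∈ C, ∀ g ∈ C, f ≠ g → finrank F (LinearMap.ker (f - g)) + 2 ≤ finrank F V := by
  obtain ⟨K, _, _, hK⟩ := exists_field_extension F (finrank F U) (by omega)
  have : FiniteDimensional F K := FiniteDimensional.of_finrank_pos (by omega)
  have : Finite K := Module.finite_of_finite F
  let e : K ≃ₗ[F] U := LinearEquiv.ofFinrankEq K U hK
  let b := finBasis F V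
  let θ : Fin (finrank F V) → K := fun i => finBasis F K (Fin.castLE (by omega) i)
  have hθ : LinearIndependent F θ :=
    (finBasis F K).linearIndependent.comp _ (Fin.castLE_injective _)
  let ev : (Fin (finrank F V) → K) →ₗ[K] K := Fintype.linearCombination K θ
  have hev : ∀ φ, ev φ = ∑ i, φ i * θ i := fun φ => by
    simp [ev, Fintype.linearCombination_apply]
  have hsurj : LinearMap.range ev = ⊤ := by
    rw [LinearMap.range_eq_top]
    intro y
    refine ⟨Pi.single ⟨0, hV⟩ (y / θ ⟨0, hV⟩), ?_⟩
    rw [hev, Finset.sum_eq_single ⟨0, hV⟩ (fun i _ hi => by simp [hi]) (by simp)]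
    simpa using div_mul_cancel₀ y (hθ.ne_zero _)
  have hker : finrank K (LinearMap.ker ev) = finrank F V - 1 := by
    have := LinearMap.finrank_range_add_finrank_ker ev
    rw [hsurj, finrank_top, finrank_self, finrank_fintype_fun_eq_card, Fintype.card_fin] at this
    omega
  let T : (Fin (finrank F V) → K) → (V →ₗ[F] U) := fun φ => e.toLinearMap ∘ₗ b.constr F φ
  have hT : Function.Injective T := by
    intro φ ψ h
    funext i
    have := LinearMap.congr_fun h (b i)
    simpa [T] using this
  refine ⟨T '' (LinearMap.ker ev : Set (Fin (finrank F V) → K)), ?_, ?_⟩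
  · rw [Set.ncard_image_of_injective _ hT, ← Nat.card_coe_set_eq]
    change Nat.card (LinearMap.ker ev) = _
    rw [Module.natCard_eq_pow_finrank (K := K), hker, Module.natCard_eq_pow_finrank (K := F), hK,
      pow_mul]
  · rintro _ ⟨φ, hφ, rfl⟩ _ ⟨ψ, hψ, rfl⟩ hne
    by_contra hlt
    apply hne
    congr 1
    rw [← sub_eq_zero]
    have hmem : ev (φ - ψ) = 0 := by
      rw [map_sub, LinearMap.mem_ker.1 hφ, LinearMap.mem_ker.1 hψ, sub_zero]
    have hsub : T φ - T ψ = e.toLinearMap ∘ₗ b.constr F (φ - ψ) := by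
      simp [T, LinearMap.comp_sub]
    rw [hsub, LinearEquiv.ker_comp] at hlt
    set χ := φ - ψ
    have hr : finrank F (LinearMap.range (b.constr F χ)) ≤ 1 := by
      have := LinearMap.finrank_range_add_finrank_ker (b.constr F χ)
      omega
    obtain ⟨k, hk⟩ := finrank_le_one_iff.1 hr
    have hχ : ∀ i, ∃ c : F, χ i = c • (k : K) := by
      intro i
      obtain ⟨c, hc⟩ := hk ⟨b.constr F χ (b i), LinearMap.mem_range_self _ _⟩
      exact ⟨c, by simpa using (congrArg Subtype.val hc).symm⟩
    choose c hc using hχ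
    rw [hev] at hmem
    have hmul : (∑ i, c i • θ i) * (k : K) = 0 := by
      rw [← hmem, Finset.sum_mul]
      refine Finset.sum_congr rfl fun i _ => ?_
      rw [hc i, smul_mul_assoc, smul_mul_assoc, mul_comm]
    funext i
    rcases mul_eq_zero.1 hmul with h | h
    · rw [hc i, Fintype.linearIndependent_iff.1 hθ c h i, zero_smul, Pi.zero_apply]
    · rw [hc i, h, smul_zero, Pi.zero_apply]

theorem exists_disjoint_lines {F K H : Type} [Field F] [Field K] [Algebra F K]
    [FiniteDimensional F K] [AddCommGroup H] [Module F H] [FiniteDimensional F H]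
    (hK : 2 ≤ finrank F K) (hH : finrank F H = finrank F K + 2) :
    ∃ M : K → K → Submodule F H, (∀ c x, finrank F (M c x) = 2) ∧
      (∀ c x y, x ≠ y → M c x ⊓ M c y = ⊥) ∧
      ∀ c d x y, c ≠ d → M c x ≠ M d y := by
  let e : ((F × F) × K) ≃ₗ[F] H := LinearEquiv.ofFinrankEq ((F × F) × K) H (by
    simp only [finrank_prod, finrank_self, hH]
    ring)
  let θ : Fin 2 → K := fun i => finBasis F K (Fin.castLE hK i)
  have hθ : LinearIndependent F θ :=
    (finBasis F K).linearIndependent.comp _ (Fin.castLE_injective _)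
  have hθ0 : θ 0 ≠ 0 := hθ.ne_zero 0
  let μ : K → K → (F × F →ₗ[F] K) := fun c x =>
    (LinearMap.toSpanSingleton F K (θ 0 * x)).coprod
      (LinearMap.toSpanSingleton F K (θ 1 * x + c))
  have hμ : ∀ c x a, μ c x a = a.1 • (θ 0 * x) + a.2 • (θ 1 * x + c) := fun c x a => by
    simp [μ]
  refine ⟨fun c x => (μ c x).graph.map e.toLinearMap, fun c x => ?_, fun c x y hxy => ?_,
    fun c d x y hcd h => hcd ?_⟩
  · rw [LinearEquiv.finrank_map_eq, LinearMap.graph_eq_range_prod, LinearMap.finrank_range_of_inj]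
    · simp
    · intro a b h
      exact congrArg Prod.fst h
  · rw [← Submodule.map_inf _ e.injective, Submodule.map_eq_bot_iff, eq_bot_iff]
    rintro ⟨a, z⟩ ⟨h1, h2⟩
    simp only [SetLike.mem_coe, LinearMap.mem_graph_iff, hμ] at h1 h2
    have hz : (a.1 • θ 0 + a.2 • θ 1) * (x - y) = 0 := by
      have := h1.symm.trans h2
      simp only [Algebra.smul_def] at this ⊢
      linear_combination this
    have ha := Fintype.linearIndependent_iff.1 hθ ![a.1, a.2] (by
      simpa using (mul_eq_zero.1 hz).resolve_right (sub_ne_zero.2 hxy))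
    have ha0 : a.1 = 0 := by simpa using ha 0
    have ha1 : a.2 = 0 := by simpa using ha 1
    rw [ha0, ha1] at h1
    simp only [Submodule.mem_bot, Prod.ext_iff]
    exact ⟨⟨ha0, ha1⟩, by simpa using h1⟩
  · have hg := Submodule.map_injective_of_injective e.injective h
    have key : ∀ a, μ c x a = μ d y a := by
      intro a
      have : (a, μ c x a) ∈ (μ d y).graph := by
        rw [← hg, LinearMap.mem_graph_iff]
      simpa [LinearMap.mem_graph_iff] using this
    have h0 := key (1, 0)
    have h1 := key (0, 1)
    simp only [hμ, one_smul, zero_smul, add_zero, zero_add] at h0 h1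
    rw [mul_left_cancel₀ hθ0 h0] at h1
    exact add_left_cancel h1

theorem card_lines {F V : Type} [Field F] [Finite F] [AddCommGroup V] [Module F V]
    [FiniteDimensional F V] (hV : 2 ≤ finrank F V) :
    Nat.card {L : Submodule F V // finrank F L = 2} *
      ((Nat.card F ^ 2 - 1) * (Nat.card F ^ 2 - Nat.card F)) =
      (Nat.card F ^ finrank F V - 1) * (Nat.card F ^ finrank F V - Nat.card F) := by
  have := Fintype.ofFinite F
  have : Finite V := Module.finite_of_finite F
  let f : {s : Fin 2 → V // LinearIndependent F s} →
      {L : Submodule F V // finrank F L = 2} := fun s =>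
    ⟨Submodule.span F (Set.range s.1), by simpa using finrank_span_eq_card s.2⟩
  have hf : ∀ L, Nat.card {s // f s = L} =
      (Nat.card F ^ 2 - 1) * (Nat.card F ^ 2 - Nat.card F) := by
    intro L
    have h := card_linearIndependent (K := F) (V := L.1) (k := 2) L.2.ge
    rw [L.2] at h
    simp only [Fin.prod_univ_two, Fin.val_zero, Fin.val_one, pow_zero, pow_one,
      ← Nat.card_eq_fintype_card] at h
    rw [← h]
    refine Nat.card_congr
      { toFun := fun s => ⟨fun i => ⟨s.1.1 i, ?_⟩, ?_⟩
        invFun := fun s => ⟨⟨fun i => s.1 i, ?_⟩, ?_⟩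
        left_inv := fun s => rfl
        right_inv := fun s => rfl }
    · exact (congrArg Subtype.val s.2).le (Submodule.subset_span (Set.mem_range_self i))
    · exact LinearIndependent.of_comp L.1.subtype s.1.2
    · exact s.2.map' L.1.subtype L.1.ker_subtype
    · refine Subtype.ext (Submodule.eq_of_le_of_finrank_eq ?_ ?_)
      · rw [Submodule.span_le]
        rintro _ ⟨i, rfl⟩
        exact (s.1 i).2
      · rw [L.2]
        exact (f _).2
  have h := card_linearIndependent (K := F) (V := V) (k := 2) hV
  simp only [Fin.prod_univ_two, Fin.val_zero, Fin.val_one, pow_zero, pow_one,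
    ← Nat.card_eq_fintype_card] at h
  have := Fintype.ofFinite {L : Submodule F V // finrank F L = 2}
  rw [← h, ← Nat.card_congr (Equiv.sigmaFiberEquiv f), Nat.card_sigma]
  simp only [hf, Finset.sum_const, Finset.card_univ, smul_eq_mul, Nat.card_eq_fintype_card]

theorem FiniteField.exists_algebraMap_eq_of_pow_card_eq {F K : Type} [Field F] [Fintype F] [Field K]
    [Algebra F K] {x : K} (hx : x ^ Fintype.card F = x) : ∃ a : F, algebraMap F K a = x := by
  have hprod : (Polynomial.X ^ Fintype.card F - Polynomial.X : Polynomial F) =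
      ∏ a : F, (Polynomial.X - Polynomial.C a) := by
    have hdeg : (Polynomial.X ^ Fintype.card F - Polynomial.X : Polynomial F).natDegree =
        Fintype.card F := FiniteField.X_pow_card_sub_X_natDegree_eq F Fintype.one_lt_card
    have hmonic : (Polynomial.X ^ Fintype.card F - Polynomial.X : Polynomial F).Monic :=
      Polynomial.monic_X_pow_sub (by
        rw [Polynomial.degree_X]
        exact_mod_cast Fintype.one_lt_card)
    have := Polynomial.prod_multiset_X_sub_C_of_monic_of_roots_card_eq hmonic (by
      rw [FiniteField.roots_X_pow_card_sub_X, hdeg]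
      rfl)
    rw [← this, FiniteField.roots_X_pow_card_sub_X]
    rfl
  have h := congrArg (Polynomial.aeval x) hprod
  simp only [map_sub, map_pow, Polynomial.aeval_X, hx, sub_self, map_prod,
    Polynomial.aeval_C] at h
  obtain ⟨a, -, ha⟩ := Finset.prod_eq_zero_iff.1 h.symm
  exact ⟨a, (sub_eq_zero.1 ha).symm⟩

theorem exists_line_coloring (F K : Type) [Field F] [Finite F] [Field K] [Algebra F K] :
    ∃ c : Submodule F K → K, ∀ L L' : Submodule F K, finrank F L = 2 → finrank F L' = 2 →
      L ⊓ L' ≠ ⊥ → c L = c L' → L = L' := by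
  classical
  have := Fintype.ofFinite F
  let φ : K →ₐ[F] K := FiniteField.frobeniusAlgHom F K
  let B : K → K → K := fun x y => x * φ y - φ x * y
  have hspan : ∀ p w, p ≠ 0 → B p w = 0 → ∃ a : F, w = a • p := by
    intro p w hp h
    have hφ : (w / p) ^ Fintype.card F = w / p := by
      change φ (w / p) = w / p
      rw [map_div₀, div_eq_div_iff ((map_ne_zero φ).2 hp) hp]
      linear_combination h
    obtain ⟨a, ha⟩ := FiniteField.exists_algebraMap_eq_of_pow_card_eq hφ
    exact ⟨a, by rw [Algebra.smul_def, ha, div_mul_cancel₀ w hp]⟩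
  have hB : ∀ x y (a b c d : F), B (a • x + b • y) (c • x + d • y) = (a * d - b * c) • B x y := by
    intro x y a b c d
    simp only [B, map_add, Algebra.smul_def, map_sub, map_mul, φ.commutes]
    ring
  have hbasis : ∀ L : Submodule F K, finrank F L = 2 → ∃ s : K, ∀ p ∈ L, p ≠ 0 →
      ∃ y ∈ L, B p y = s ∧ L = Submodule.span F {p, y} := by
    intro L hL
    have : FiniteDimensional F L := FiniteDimensional.of_finrank_pos (by omega)
    let b := finBasisOfFinrankEq F L hL
    refine ⟨B (b 0) (b 1), fun p hp hp0 => ?_⟩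
    have hrep : ∀ v : L, (v : K) = b.repr v 0 • (b 0 : K) + b.repr v 1 • (b 1 : K) := by
      intro v
      conv_lhs => rw [← b.sum_repr v]
      simp only [Fin.sum_univ_two, Submodule.coe_add, Submodule.coe_smul]
    set α := b.repr ⟨p, hp⟩ 0
    set β := b.repr ⟨p, hp⟩ 1
    have hpe : p = α • (b 0 : K) + β • (b 1 : K) := hrep ⟨p, hp⟩
    obtain ⟨γ, δ, hdet⟩ : ∃ γ δ : F, α * δ - β * γ = 1 := by
      by_cases hα : α = 0
      · have hβ : β ≠ 0 := by
          rintro hβ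
          exact hp0 (by rw [hpe, hα, hβ]; simp)
        exact ⟨-β⁻¹, 0, by simp [hβ]⟩
      · exact ⟨0, α⁻¹, by simp [hα]⟩
    refine ⟨γ • (b 0 : K) + δ • (b 1 : K),
      L.add_mem (L.smul_mem _ (b 0).2) (L.smul_mem _ (b 1).2), ?_, ?_⟩
    · rw [hpe, hB, hdet, one_smul]
    · refine le_antisymm (fun v hv => ?_) ?_
      · have hve := hrep ⟨v, hv⟩
        simp only at hve
        rw [Submodule.mem_span_pair]
        set v0 := b.repr ⟨v, hv⟩ 0
        set v1 := b.repr ⟨v, hv⟩ 1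
        refine ⟨v0 * δ - v1 * γ, α * v1 - β * v0, ?_⟩
        have hdet' := congrArg (algebraMap F K) hdet
        rw [hpe, hve]
        simp only [Algebra.smul_def, map_sub, map_mul, map_one] at hdet' ⊢
        linear_combination (algebraMap F K v0 * b 0 + algebraMap F K v1 * b 1) * hdet'
      · rw [Submodule.span_le]
        rintro v (rfl | rfl)
        · exact hp
        · exact L.add_mem (L.smul_mem _ (b 0).2) (L.smul_mem _ (b 1).2)
  choose s hs using hbasis
  refine ⟨fun L => if h : finrank F L = 2 then s L h else 0, fun L L' hL hL' hne hc => ?_⟩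
  simp only [hL, hL', dif_pos] at hc
  obtain ⟨p, ⟨hp, hp'⟩, hp0⟩ := Submodule.exists_mem_ne_zero_of_ne_bot hne
  obtain ⟨y, hy, hBy, hLy⟩ := hs L hL p hp hp0
  obtain ⟨z, hz, hBz, -⟩ := hs L' hL' p hp' hp0
  obtain ⟨a, ha⟩ := hspan p (y - z) hp0 (by
    have : B p (y - z) = B p y - B p z := by
      simp only [B, map_sub]
      ring
    rw [this, hBy, hBz, hc, sub_self])
  have hy' : y ∈ L' := by
    rw [sub_eq_iff_eq_add.1 ha]
    exact L'.add_mem (L'.smul_mem a hp') hz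
  have : FiniteDimensional F L' := FiniteDimensional.of_finrank_pos (by omega)
  refine Submodule.eq_of_le_of_finrank_eq ?_ (hL.trans hL'.symm)
  rw [hLy, Submodule.span_le]
  rintro v (rfl | rfl)
  · exact hp'
  · exact hy'

/-- The subspaces of `H × E` projecting onto `X` and meeting `E` in `L` are the subspaces
`quotientGraph X L φ` for the linear maps `φ : X → E ⧸ L`. -/
def quotientGraph {F H E : Type} [Field F] [AddCommGroup H] [Module F H] [AddCommGroup E]
    [Module F E] (X : Submodule F H) (L : Submodule F E) (φ : X →ₗ[F] E ⧸ L) :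
    Submodule F (H × E) where
  carrier := {p | ∃ h : p.1 ∈ X, L.mkQ p.2 = φ ⟨p.1, h⟩}
  zero_mem' := ⟨X.zero_mem, by
    rw [Prod.snd_zero, map_zero]
    exact (map_zero φ).symm⟩
  add_mem' := by
    rintro p r ⟨hp, ep⟩ ⟨hr, er⟩
    exact ⟨X.add_mem hp hr, by
      rw [Prod.snd_add, map_add, ep, er, ← map_add]
      rfl⟩
  smul_mem' := by
    rintro a p ⟨hp, ep⟩
    exact ⟨X.smul_mem a hp, by
      rw [Prod.smul_snd, map_smul, ep, ← map_smul]
      rfl⟩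

section QuotientGraph

variable {F H E : Type} [Field F] [AddCommGroup H] [Module F H] [AddCommGroup E] [Module F E]

theorem finrank_eq_finrank_map_fst_add [FiniteDimensional F H] [FiniteDimensional F E]
    (W : Submodule F (H × E)) :
    finrank F W = finrank F (W.map (LinearMap.fst F H E)) +
      finrank F (W.comap (LinearMap.inr F H E)) := by
  rw [← LinearMap.finrank_range_add_finrank_ker ((LinearMap.fst F H E).domRestrict W),
    LinearMap.range_domRestrict]
  congr 1
  refine LinearEquiv.finrank_eq
    { toFun := fun w => ⟨w.1.1.2, ?_⟩
      invFun := fun e => ⟨⟨(0, e.1), e.2⟩, rfl⟩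
      map_add' := fun _ _ => rfl
      map_smul' := fun _ _ => rfl
      left_inv := ?_
      right_inv := fun _ => rfl }
  · have h : w.1.1.1 = 0 := w.2
    have : LinearMap.inr F H E w.1.1.2 = w.1.1 := Prod.ext h.symm rfl
    rw [Submodule.mem_comap, this]
    exact w.1.2
  · rintro ⟨⟨⟨x, e⟩, hw⟩, h⟩
    have h : x = 0 := h
    subst h
    rfl

theorem map_fst_quotientGraph (X : Submodule F H) (L : Submodule F E) (φ : X →ₗ[F] E ⧸ L) :
    (quotientGraph X L φ).map (LinearMap.fst F H E) = X := by
  ext x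
  constructor
  · rintro ⟨p, ⟨hp, -⟩, rfl⟩
    exact hp
  · intro hx
    obtain ⟨e, he⟩ := L.mkQ_surjective (φ ⟨x, hx⟩)
    exact ⟨(x, e), ⟨hx, he⟩, rfl⟩

theorem comap_inr_quotientGraph (X : Submodule F H) (L : Submodule F E) (φ : X →ₗ[F] E ⧸ L) :
    (quotientGraph X L φ).comap (LinearMap.inr F H E) = L := by
  ext e
  rw [← Submodule.Quotient.mk_eq_zero L, ← Submodule.mkQ_apply]
  constructor
  · rintro ⟨h, he⟩
    exact he.trans (map_zero φ)
  · intro he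
    exact ⟨X.zero_mem, he.trans (map_zero φ).symm⟩

theorem finrank_quotientGraph [FiniteDimensional F H] [FiniteDimensional F E]
    (X : Submodule F H) (L : Submodule F E) (φ : X →ₗ[F] E ⧸ L) :
    finrank F (quotientGraph X L φ) = finrank F X + finrank F L := by
  rw [finrank_eq_finrank_map_fst_add, map_fst_quotientGraph, comap_inr_quotientGraph]

theorem finrank_quotientGraph_inf_le [FiniteDimensional F H] [FiniteDimensional F E]
    (X X' : Submodule F H) (L L' : Submodule F E) (φ : X →ₗ[F] E ⧸ L) (φ' : X' →ₗ[F] E ⧸ L') :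
    finrank F ↥(quotientGraph X L φ ⊓ quotientGraph X' L' φ') ≤
      finrank F ↥(X ⊓ X') + finrank F ↥(L ⊓ L') := by
  rw [finrank_eq_finrank_map_fst_add, Submodule.comap_inf, comap_inr_quotientGraph,
    comap_inr_quotientGraph]
  refine Nat.add_le_add_right (Submodule.finrank_mono ?_) _
  exact (Submodule.map_inf_le _).trans_eq (by rw [map_fst_quotientGraph, map_fst_quotientGraph])

theorem finrank_quotientGraph_inf_le_of_ker [FiniteDimensional F H] [FiniteDimensional F E]
    (X : Submodule F H) (L : Submodule F E) (φ φ' : X →ₗ[F] E ⧸ L) :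
    finrank F ↥(quotientGraph X L φ ⊓ quotientGraph X L φ') ≤
      finrank F (LinearMap.ker (φ - φ')) + finrank F L := by
  rw [finrank_eq_finrank_map_fst_add, Submodule.comap_inf, comap_inr_quotientGraph,
    comap_inr_quotientGraph, inf_idem, ← Submodule.finrank_map_subtype_eq X]
  refine Nat.add_le_add_right (Submodule.finrank_mono ?_) _
  rintro _ ⟨p, ⟨⟨hp, ep⟩, ⟨_, ep'⟩⟩, rfl⟩
  exact ⟨⟨p.1, hp⟩, by simp [← ep, ← ep'], rfl⟩

end QuotientGraph

theorem four_le_subspaceDist {F V : Type} [Field F] [AddCommGroup V] [Module F V]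
    [FiniteDimensional F V] {U W : Submodule F V} (hU : finrank F U = 4) (hW : finrank F W = 4) :
    4 ≤ subspaceDist U W ↔ finrank F ↥(U ⊓ W) ≤ 2 := by
  have := Submodule.finrank_sup_add_finrank_inf_eq U W
  unfold subspaceDist
  omega

theorem finrank_inf_lt_of_ne {F V : Type} [Field F] [AddCommGroup V] [Module F V]
    [FiniteDimensional F V] {U W : Submodule F V} (h : finrank F U = finrank F W) (hne : U ≠ W) :
    finrank F ↥(U ⊓ W) < finrank F U := by
  refine Submodule.finrank_lt_finrank_of_lt (lt_of_le_of_ne inf_le_left fun heq => hne ?_)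
  exact Submodule.eq_of_le_of_finrank_eq (inf_eq_left.1 heq) h

/-- Codewords glued from pairs `(X, L)` of subspaces and a rank metric code for each pair. -/
theorem exists_glued_code {F H E ι : Type} [Field F] [Finite F] [Finite ι] [AddCommGroup H]
    [Module F H] [AddCommGroup E] [Module F E] [FiniteDimensional F H] [FiniteDimensional F E]
    (X : ι → Submodule F H) (L : ι → Submodule F E)
    (hXL : ∀ i, finrank F (X i) + finrank F (L i) = 4) (hX : ∀ i, 0 < finrank F (X i))
    (hE : 4 ≤ finrank F E)
    (hdist : ∀ i j, i ≠ j → finrank F ↥(X i ⊓ X j) + finrank F ↥(L i ⊓ L j) ≤ 2) :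
    ∃ S : Set (Submodule F (H × E)),
      S.ncard = ∑ᶠ i, Nat.card F ^ ((finrank F E - finrank F (L i)) * (finrank F (X i) - 1)) ∧
      (∀ W ∈ S, finrank F W = 4) ∧
      ∀ W ∈ S, ∀ W' ∈ S, W ≠ W' → finrank F ↥(W ⊓ W') ≤ 2 := by
  have hq : ∀ i, finrank F (E ⧸ L i) = finrank F E - finrank F (L i) := fun i => by
    rw [← Submodule.finrank_quotient_add_finrank (L i), Nat.add_sub_cancel]
  choose C hC hCd using fun i => exists_rankCode (F := F) (V := X i) (U := E ⧸ L i) (hX i) (by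
    have := hXL i
    have := hq i
    omega)
  have : ∀ i, Finite (X i →ₗ[F] E ⧸ L i) := fun i => Module.finite_of_finite F
  let W : (Σ i, C i) → Submodule F (H × E) := fun p => quotientGraph (X p.1) (L p.1) p.2.1
  have hW : ∀ p, finrank F (W p) = 4 := fun p => by rw [finrank_quotientGraph, hXL]
  have hWd : ∀ p r, p ≠ r → finrank F ↥(W p ⊓ W r) ≤ 2 := by
    rintro ⟨i, φ⟩ ⟨j, ψ⟩ hne
    by_cases hij : i = j
    · subst hij
      have hφ : φ.1 ≠ ψ.1 := fun h => hne (by rw [Subtype.ext h])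
      have h1 := hCd i φ.1 φ.2 ψ.1 ψ.2 hφ
      have h2 := finrank_quotientGraph_inf_le_of_ker (X i) (L i) φ.1 ψ.1
      have h3 := hXL i
      change finrank F ↥(quotientGraph (X i) (L i) φ.1 ⊓ quotientGraph (X i) (L i) ψ.1) ≤ 2
      omega
    · exact (finrank_quotientGraph_inf_le _ _ _ _ _ _).trans (hdist i j hij)
  have hinj : Function.Injective W := by
    intro p r h
    by_contra hne
    have h1 := hWd p r hne
    rw [← h, inf_idem, hW] at h1
    omega
  refine ⟨Set.range W, ?_, ?_, ?_⟩
  · have := Fintype.ofFinite ι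
    rw [← Nat.card_coe_set_eq, Nat.card_range_of_injective hinj, Nat.card_sigma,
      finsum_eq_sum_of_fintype]
    exact Finset.sum_congr rfl fun i _ => by rw [Nat.card_coe_set_eq, hC, hq]
  · rintro _ ⟨p, rfl⟩
    exact hW p
  · rintro _ ⟨p, rfl⟩ _ ⟨r, rfl⟩ hne
    exact hWd p r fun h => hne (h ▸ rfl)

theorem card_lines_of_finrank_eq_six {F V : Type} [Field F] [Finite F] [AddCommGroup V]
    [Module F V] [FiniteDimensional F V] (hV : finrank F V = 6) :
    Nat.card {L : Submodule F V // finrank F L = 2} =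
      (Nat.card F ^ 4 + Nat.card F ^ 2 + 1) *
        (Nat.card F ^ 4 + Nat.card F ^ 3 + Nat.card F ^ 2 + Nat.card F + 1) := by
  have h := card_lines (F := F) (V := V) (by omega)
  rw [hV] at h
  have hq : 1 < Nat.card F := Finite.one_lt_card
  set q := Nat.card F
  have h1 : 1 ≤ q ^ 2 := Nat.one_le_pow _ _ (by omega)
  have h2 : q ≤ q ^ 2 := Nat.le_self_pow (by norm_num) q
  have h3 : 1 ≤ q ^ 6 := Nat.one_le_pow _ _ (by omega)
  have h4 : q ≤ q ^ 6 := Nat.le_self_pow (by norm_num) q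
  zify [h1, h2, h3, h4] at h ⊢
  have hq' : (1 : ℤ) < q := by exact_mod_cast hq
  have hne : ((q : ℤ) ^ 2 - 1) * ((q : ℤ) ^ 2 - q) ≠ 0 :=
    mul_ne_zero (by nlinarith) (by nlinarith)
  apply mul_right_cancel₀ hne
  rw [h]
  ring

theorem codeSize_le (q N : ℕ) (hq : 2 ≤ q) :
    N * q ^ 18 + (q ^ 18 + 2 * q ^ 16 + 3 * q ^ 15 + 5 * q ^ 14 + q ^ 13 + 4 * q ^ 12 +
      6 * q ^ 11 + 10 * q ^ 10 + 8 * q ^ 9 + 8 * q ^ 8 + 4 * q ^ 7 + 2 * q ^ 6 + q ^ 5 +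
      2 * q ^ 4 + q ^ 2 + 1) ≤
    N * q ^ 18 + (q ^ 4 + q ^ 2 + 1) * (q ^ 4 + q ^ 3 + q ^ 2 + q + 1) * q ^ 6 * q ^ 4 := by
  obtain ⟨r, rfl⟩ := Nat.exists_eq_add_of_le hq
  refine Nat.add_le_add_left ?_ _
  ring_nf
  gcongr <;> norm_num

theorem exists_code_prod {F K : Type} [Field F] [Finite F] [Field K] [Algebra F K]
    (hK : finrank F K = 6) (S : Set (Submodule F (Fin 8 → F)))
    (hS : ∀ X ∈ S, finrank F X = 4)
    (hSd : ∀ X ∈ S, ∀ Y ∈ S, X ≠ Y → finrank F ↥(X ⊓ Y) ≤ 2) :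
    ∃ T : Set (Submodule F ((Fin 8 → F) × K)),
      T.ncard = S.ncard * Nat.card F ^ 18 +
        (Nat.card F ^ 4 + Nat.card F ^ 2 + 1) *
        (Nat.card F ^ 4 + Nat.card F ^ 3 + Nat.card F ^ 2 + Nat.card F + 1) *
        Nat.card F ^ 6 * Nat.card F ^ 4 ∧
      (∀ W ∈ T, finrank F W = 4) ∧
      ∀ W ∈ T, ∀ W' ∈ T, W ≠ W' → finrank F ↥(W ⊓ W') ≤ 2 := by
  have : FiniteDimensional F K := FiniteDimensional.of_finrank_pos (by omega)
  have : Finite K := Module.finite_of_finite F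
  obtain ⟨c, hc⟩ := exists_line_coloring F K
  obtain ⟨M, hM, hMd, hMne⟩ := exists_disjoint_lines (F := F) (K := K) (H := Fin 8 → F)
    (by omega) (by rw [hK, finrank_fin_fun])
  let Lines := {L : Submodule F K // finrank F L = 2}
  let X : S ⊕ Lines × K → Submodule F (Fin 8 → F) :=
    Sum.elim (fun X => X.1) (fun p => M (c p.1.1) p.2)
  let L : S ⊕ Lines × K → Submodule F K := Sum.elim (fun _ => ⊥) (fun p => p.1.1)
  have mixed : ∀ (A : S) (p : Lines × K),
      finrank F ↥(A.1 ⊓ M (c p.1.1) p.2) + finrank F ↥((⊥ : Submodule F K) ⊓ p.1.1) ≤ 2 := by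
    intro A p
    rw [bot_inf_eq, finrank_bot, add_zero]
    exact (Submodule.finrank_mono inf_le_right).trans (hM (c p.1.1) p.2).le
  have hdist : ∀ i j, i ≠ j → finrank F ↥(X i ⊓ X j) + finrank F ↥(L i ⊓ L j) ≤ 2 := by
    rintro (A | p) (B | r) hne
    · have hAB : A.1 ≠ B.1 := fun h => hne (by rw [Subtype.ext h])
      change finrank F ↥(A.1 ⊓ B.1) + finrank F ↥((⊥ : Submodule F K) ⊓ ⊥) ≤ 2
      rw [inf_idem, finrank_bot]
      exact hSd A.1 A.2 B.1 B.2 hAB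
    · exact mixed A r
    · have := mixed B p
      rw [inf_comm B.1, inf_comm ⊥] at this
      exact this
    · obtain ⟨⟨A, hA⟩, x⟩ := p
      obtain ⟨⟨B, hB⟩, y⟩ := r
      change finrank F ↥(M (c A) x ⊓ M (c B) y) + finrank F ↥(A ⊓ B) ≤ 2
      by_cases hAB : A = B
      · subst hAB
        have hxy : x ≠ y := by
          rintro rfl
          exact hne rfl
        rw [hMd _ _ _ hxy, finrank_bot, inf_idem, hA]
      · have h1 := finrank_inf_lt_of_ne (hA.trans hB.symm) hAB
        by_cases hcAB : c A = c B
        · have hbot : A ⊓ B = ⊥ := by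
            by_contra h
            exact hAB (hc A B hA hB h hcAB)
          rw [hbot, finrank_bot, add_zero, ← hM (c A) x]
          exact Submodule.finrank_mono inf_le_left
        · have h2 := finrank_inf_lt_of_ne ((hM (c A) x).trans (hM (c B) y).symm)
            (hMne _ _ _ _ hcAB)
          rw [hM] at h2
          omega
  have hXL : ∀ i, finrank F (X i) + finrank F (L i) = 4 := by
    rintro (A | p)
    · change finrank F A.1 + finrank F (⊥ : Submodule F K) = 4
      rw [hS A.1 A.2, finrank_bot]
    · change finrank F (M (c p.1.1) p.2) + finrank F p.1.1 = 4
      rw [hM, p.1.2]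
  have hX : ∀ i, 0 < finrank F (X i) := by
    rintro (A | p)
    · exact (hS A.1 A.2).symm ▸ Nat.succ_pos 3
    · exact (hM (c p.1.1) p.2).symm ▸ Nat.succ_pos 1
  obtain ⟨T, hT, hT4, hTd⟩ := exists_glued_code X L hXL hX (by omega) hdist
  refine ⟨T, ?_, hT4, hTd⟩
  have hXl : ∀ A, finrank F (X (Sum.inl A)) = 4 := fun A => hS A.1 A.2
  have hLl : ∀ A, finrank F (L (Sum.inl A)) = 0 := fun A => finrank_bot F K
  have hXr : ∀ p, finrank F (X (Sum.inr p)) = 2 := fun p => hM (c p.1.1) p.2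
  have hLr : ∀ p, finrank F (L (Sum.inr p)) = 2 := fun p => p.1.2
  have := Fintype.ofFinite S
  have := Fintype.ofFinite (Lines × K)
  rw [hT, finsum_eq_sum_of_fintype, Fintype.sum_sum_type]
  simp only [hXl, hLl, hXr, hLr, hK, Finset.sum_const, smul_eq_mul, Finset.card_univ,
    ← Nat.card_eq_fintype_card]
  rw [Nat.card_prod, card_lines_of_finrank_eq_six hK,
    Module.natCard_eq_pow_finrank (K := F) (V := K),
    hK, Nat.card_coe_set_eq]

theorem statement12 (q N : ℕ) (hq : IsPrimePow q)
    (F : Type) [Field F] [Fintype F] (hcard : Fintype.card F = q)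
    (h : ∃ S : Set (Submodule F (Fin 8 → F)), S.ncard = N ∧
      (∀ X ∈ S, Module.finrank F ↥X = 4) ∧
      (∀ X ∈ S, ∀ Y ∈ S, X ≠ Y → 4 ≤ subspaceDist X Y)) :
    ∃ S : Set (Submodule F (Fin 14 → F)),
      S.ncard = N * q ^ 18 + (q ^ 18 + 2 * q ^ 16 + 3 * q ^ 15 + 5 * q ^ 14 + q ^ 13 + 4 * q ^ 12 + 6 * q ^ 11 + 10 * q ^ 10 + 8 * q ^ 9 + 8 * q ^ 8 + 4 * q ^ 7 + 2 * q ^ 6 + q ^ 5 + 2 * q ^ 4 + q ^ 2 + 1) ∧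
      (∀ X ∈ S, Module.finrank F ↥X = 4) ∧
      (∀ X ∈ S, ∀ Y ∈ S, X ≠ Y → 4 ≤ subspaceDist X Y) := by
  obtain ⟨S, hSN, hS, hSd⟩ := h
  obtain ⟨K, _, _, hK⟩ := exists_field_extension F 6 (by norm_num)
  have : FiniteDimensional F K := FiniteDimensional.of_finrank_pos (by omega)
  have hqF : Nat.card F = q := by rw [Nat.card_eq_fintype_card, hcard]
  obtain ⟨T, hTcard, hT, hTd⟩ := exists_code_prod hK S hS fun X hX Y hY hne =>
    (four_le_subspaceDist (hS X hX) (hS Y hY)).1 (hSd X hX Y hY hne)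
  rw [hqF, hSN] at hTcard
  have hle := (codeSize_le q N hq.two_le).trans_eq hTcard.symm
  obtain ⟨T', hT', hcard'⟩ := Set.exists_subset_card_eq hle
  let e : ((Fin 8 → F) × K) ≃ₗ[F] (Fin 14 → F) :=
    LinearEquiv.ofFinrankEq ((Fin 8 → F) × K) (Fin 14 → F) (by
      rw [finrank_prod, hK, finrank_fin_fun, finrank_fin_fun])
  have he : ∀ W : Submodule F ((Fin 8 → F) × K),
      finrank F (W.map e.toLinearMap) = finrank F W := fun W => LinearEquiv.finrank_map_eq e W
  refine ⟨Submodule.map e.toLinearMap '' T', ?_, ?_, ?_⟩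
  · rw [Set.ncard_image_of_injective _ (Submodule.map_injective_of_injective e.injective), hcard']
  · rintro _ ⟨W, hW, rfl⟩
    exact (he W).trans (hT W (hT' hW))
  · rintro _ ⟨W, hW, rfl⟩ _ ⟨W', hW', rfl⟩ hne
    rw [four_le_subspaceDist ((he W).trans (hT W (hT' hW))) ((he W').trans (hT W' (hT' hW'))),
      ← Submodule.map_inf _ e.injective, he]
    exact hTd W (hT' hW) W' (hT' hW') fun h => hne (h ▸ rfl)
end
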